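/- Suppose I^un = [(x, y)^2 + (ax + by)] ∩ (u, v) for linear forms u, v, x, y and homogeneous forms a, b of equal degree such that ht((a, b, x, y)) = 4. Then pd(R/I) ≤ 4. -/

import Mathlib

open MvPolynomial Filter CategoryTheory

noncomputable section

/-- The height of an ideal `J`: the infimum of the heights of the prime ideals containing it. -/
def idealHeight {R : Type} [CommRing R] (J : Ideal R) : ℕ∞ :=
  ⨅ p ∈ {p : {q : Ideal R // q.IsPrime} | J ≤ p.1}, Order.height p

/-- `pdQuotLE J n` holds iff `R ⧸ J` admits a projective resolution of length at most `n`,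
i.e. the projective dimension of `R ⧸ J` as an `R`-module is at most `n`. -/
def pdQuotLE {R : Type} [CommRing R] (J : Ideal R) (n : ℕ) : Prop :=
  ∃ P : ProjectiveResolution (ModuleCat.of R (R ⧸ J)),
    ∀ i, n < i → Limits.IsZero (P.complex.X i)

/-- The `p`-primary component of `J` for `p` a minimal prime of `J`:
the saturation of `J` at `p`. -/
def primaryComponent {R : Type} [CommRing R] (J p : Ideal R) : Ideal R :=
  ⨆ (s : R) (_ : s ∉ p), Submodule.colon J (Ideal.span {s})

/-- The unmixed part `J^un` of `J`: the intersection of the primary components of `J`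
corresponding to the minimal primes of `J` of minimal height. -/
def unmixedPart {R : Type} [CommRing R] (J : Ideal R) : Ideal R :=
  ⨅ p ∈ {p : Ideal R | p.IsPrime ∧ J ≤ p ∧ idealHeight p = idealHeight J},
    primaryComponent J p

/-- A linear prime: a prime ideal generated by forms of degree one. -/
def IsLinearPrime {k : Type} [CommSemiring k] {N : ℕ} (p : Ideal (MvPolynomial (Fin N) k)) : Prop :=
  p.IsPrime ∧ ∃ S : Set (MvPolynomial (Fin N) k), (∀ ℓ ∈ S, ℓ.IsHomogeneous 1) ∧ p = Ideal.span S

/-- A homogeneous ideal: an ideal generated by homogeneous elements. -/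
def IsHomogeneousIdeal {k : Type} [CommSemiring k] {N : ℕ}
    (J : Ideal (MvPolynomial (Fin N) k)) : Prop :=
  ∃ S : Set (MvPolynomial (Fin N) k), (∀ g ∈ S, ∃ d, g.IsHomogeneous d) ∧ J = Ideal.span S

/-- `[B]_n`: the ideal generated by all forms of degree `n` belonging to `B`. -/
def degreePart {k : Type} [CommSemiring k] {N : ℕ} (B : Ideal (MvPolynomial (Fin N) k)) (n : ℕ) :
    Ideal (MvPolynomial (Fin N) k) :=
  Ideal.span {f | f ∈ B ∧ f.IsHomogeneous n}

/-- The Hilbert–Samuel function of `R/J` with respect to the irrelevant maximal ideal: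
`n ↦ length (R / (J + 𝔪^n)) = dim_k (R / (J + 𝔪^n))`. -/
def hilbertSamuelFn {k : Type} [Field k] {N : ℕ} (J : Ideal (MvPolynomial (Fin N) k))
    (n : ℕ) : ℕ :=
  Module.finrank k
    (MvPolynomial (Fin N) k ⧸
      (J ⊔ (Ideal.span (Set.range (MvPolynomial.X : Fin N → MvPolynomial (Fin N) k))) ^ n))

/-- `HasMultiplicity J d e`: the quotient `R/J` has Krull dimension `d` and Hilbert–Samuel
multiplicity `e`, expressed through the asymptotics `d! · HS_J(n) / n^d → e` of the
Hilbert–Samuel function. -/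
def HasMultiplicity {k : Type} [Field k] {N : ℕ} (J : Ideal (MvPolynomial (Fin N) k))
    (d e : ℕ) : Prop :=
  Tendsto (fun n : ℕ => (Nat.factorial d : ℝ) * (hilbertSamuelFn J n : ℝ) / (n : ℝ) ^ d)
    atTop (nhds (e : ℝ))

/-- An ideal of `R` is extended from a subalgebra `A` if it is generated by elements of `A`. -/
def extendedFrom {k R : Type} [CommRing k] [CommRing R] [Algebra k R]
    (K : Ideal R) (A : Subalgebra k R) : Prop :=
  ∃ S : Set R, S ⊆ (A : Set R) ∧ K = Ideal.span S


section PD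
universe u
variable {R : Type} [CommRing R]

/-- Splicing a resolution of the kernel. -/
theorem exists_res_of_pd {C : Type*} [Category C] [Abelian C] [EnoughProjectives C] (n : ℕ) :
    ∀ (X : C), HasProjectiveDimensionLT X (n + 1) →
      ∃ P : ProjectiveResolution X, ∀ i, n < i → Limits.IsZero (P.complex.X i) := by
  induction n with
  | zero =>
    intro X hX
    have : Projective X := projective_iff_hasProjectiveDimensionLT_one.mpr hX
    refine ⟨ProjectiveResolution.self X, fun i hi => ?_⟩
    apply HomologicalComplex.isZero_single_obj_X
    omega
  | succ n ih =>
    intro X hX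
    let p := Projective.π X
    let S : ShortComplex C := ShortComplex.mk (Limits.kernel.ι p) p (by simp)
    have hS : S.ShortExact := { exact := ShortComplex.exact_kernel p }
    have hK : HasProjectiveDimensionLT S.X₁ (n + 1) :=
      (hS.hasProjectiveDimensionLT_X₃_iff n (by dsimp [S]; infer_instance)).mp hX
    obtain ⟨Q, hQ⟩ := ih _ hK
    have hQ0 : Q.complex.d 1 0 ≫ Q.π.f 0 = 0 := Q.complex_d_comp_π_f_zero
    let q : Q.complex.X 0 ⟶ S.X₁ := Q.π.f 0
    have hw : Q.complex.d 1 0 ≫ (q ≫ S.f) = 0 := by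
      rw [← Category.assoc]; 
      have : Q.complex.d 1 0 ≫ q = 0 := hQ0
      rw [this, Limits.zero_comp]
    have hq : Epi q := inferInstanceAs (Epi (Q.π.f 0))
    have hz : (q ≫ S.f) ≫ p = 0 := by
      rw [Category.assoc]; 
      have : S.f ≫ p = 0 := S.zero
      rw [this, Limits.comp_zero]
    let A := ChainComplex.augment Q.complex (q ≫ S.f) hw
    have hmono : Mono S.f := hS.mono_f
    have ex0 : (ShortComplex.mk (q ≫ S.f) p hz).Exact := by
      let α : ShortComplex.mk (q ≫ S.f) p hz ⟶ S :=
        { τ₁ := q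
          τ₂ := 𝟙 _
          τ₃ := 𝟙 _ }
      have : Epi α.τ₁ := hq
      have : IsIso α.τ₂ := inferInstanceAs (IsIso (𝟙 _))
      have : Mono α.τ₃ := inferInstanceAs (Mono (𝟙 _))
      exact (ShortComplex.exact_iff_of_epi_of_isIso_of_mono α).mpr hS.exact
    have ex1 : (ShortComplex.mk (Q.complex.d 1 0) (q ≫ S.f) hw).Exact := by
      have e : (ShortComplex.mk (Q.complex.d 1 0) q hQ0).Exact := Q.exact₀
      let α : ShortComplex.mk (Q.complex.d 1 0) q hQ0 ⟶
          ShortComplex.mk (Q.complex.d 1 0) (q ≫ S.f) hw :=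
        { τ₁ := 𝟙 _
          τ₂ := 𝟙 _
          τ₃ := S.f }
      have : Epi α.τ₁ := inferInstanceAs (Epi (𝟙 _))
      have : IsIso α.τ₂ := inferInstanceAs (IsIso (𝟙 _))
      have : Mono α.τ₃ := hmono
      exact (ShortComplex.exact_iff_of_epi_of_isIso_of_mono α).mp e
    have hproj : ∀ i, Projective (A.X i) := by
      intro i
      cases i with
      | zero => exact inferInstanceAs (Projective (Projective.over X))
      | succ i => exact Q.projective i
    have hex : ∀ i, A.ExactAt (i + 1) := by
      intro i
      rw [HomologicalComplex.exactAt_iff' _ (i + 1 + 1) (i + 1) i (by simp) (by simp)]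
      cases i with
      | zero => exact ex1
      | succ i => exact Q.exact_succ i
    have hp0 : ((ChainComplex.toSingle₀Equiv A X).symm ⟨p, hz⟩).f 0 = p :=
      ChainComplex.toSingle₀Equiv_symm_apply_f_zero (C := A) p hz
    refine ⟨{ complex := A
              projective := hproj
              π := (ChainComplex.toSingle₀Equiv A X).symm ⟨p, hz⟩
              quasiIso := ⟨fun i => ?_⟩ }, ?_⟩
    · cases i with
      | zero =>
        rw [ChainComplex.quasiIsoAt₀_iff, ShortComplex.quasiIso_iff_of_zeros']
        · refine (ShortComplex.exact_and_epi_g_iff_of_iso ?_).2 ⟨ex0, by dsimp [p]; infer_instance⟩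
          exact ShortComplex.isoMk (Iso.refl _) (Iso.refl _) (Iso.refl _)
            ((Category.id_comp (q ≫ S.f)).trans (Category.comp_id (q ≫ S.f)).symm)
            ((Category.id_comp p).trans (hp0.symm.trans (Category.comp_id _).symm))
        all_goals rfl
      | succ i =>
        rw [quasiIsoAt_iff_exactAt']
        · apply hex
        · apply ChainComplex.exactAt_succ_single_obj
    · intro i hi
      cases i with
      | zero => omega
      | succ i => exact hQ i (by omega)

/-- `pd (R/J) < n`. -/
def PdLT (J : Ideal R) (n : ℕ) : Prop :=
  HasProjectiveDimensionLT (ModuleCat.of R (R ⧸ J)) n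

theorem PdLT.mono {J : Ideal R} {n m : ℕ} (h : PdLT J n) (hnm : n ≤ m) : PdLT J m := by
  unfold PdLT at *
  exact hasProjectiveDimensionLT_of_ge _ n m hnm

theorem pd_bot : PdLT (⊥ : Ideal R) 1 := by
  unfold PdLT
  have : Module.Projective R (R ⧸ (⊥ : Ideal R)) :=
    Module.Projective.of_equiv (Submodule.quotEquivOfEqBot (⊥ : Ideal R) rfl).symm
  have : Projective (ModuleCat.of R (R ⧸ (⊥ : Ideal R))) :=
    (IsProjective.iff_projective _).mp this
  infer_instance

/-- `0 → R/(J:w) → R/J → R/(J+w) → 0`. -/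
theorem pd_step {J L : Ideal R} (w : R) (n : ℕ) (hL : ∀ r, r ∈ L ↔ r * w ∈ J)
    (h1 : PdLT L n) (h2 : PdLT J (n + 1)) : PdLT (J ⊔ Ideal.span {w}) (n + 1) := by
  unfold PdLT at *
  let f : (R ⧸ L) →ₗ[R] (R ⧸ J) :=
    Submodule.mapQ L J (LinearMap.toSpanSingleton R R w) (by
      intro r hr
      simpa using (hL r).mp hr)
  let g : (R ⧸ J) →ₗ[R] (R ⧸ (J ⊔ Ideal.span {w})) :=
    Submodule.mapQ J _ LinearMap.id (by
      intro r hr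
      exact Ideal.mem_sup_left hr)
  have fmk : ∀ r : R, f (Submodule.Quotient.mk r) = Submodule.Quotient.mk (r * w) := fun r => rfl
  have gmk : ∀ r : R, g (Submodule.Quotient.mk r) = Submodule.Quotient.mk r := fun r => rfl
  have hf : Function.Injective f := by
    rw [← LinearMap.ker_eq_bot, LinearMap.ker_eq_bot']
    intro m hm
    obtain ⟨r, rfl⟩ := Submodule.Quotient.mk_surjective _ m
    rw [fmk, Submodule.Quotient.mk_eq_zero] at hm
    rw [Submodule.Quotient.mk_eq_zero]
    exact (hL r).mpr hm
  have hg : Function.Surjective g := by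
    intro m
    obtain ⟨r, rfl⟩ := Submodule.Quotient.mk_surjective _ m
    exact ⟨Submodule.Quotient.mk r, gmk r⟩
  have hfg : Function.Exact f g := by
    intro m
    obtain ⟨r, rfl⟩ := Submodule.Quotient.mk_surjective _ m
    constructor
    · intro h
      rw [gmk, Submodule.Quotient.mk_eq_zero, Submodule.mem_sup] at h
      obtain ⟨j, hj, t, ht, rfl⟩ := h
      obtain ⟨s, rfl⟩ := Ideal.mem_span_singleton'.mp ht
      refine ⟨Submodule.Quotient.mk s, ?_⟩
      rw [fmk, Submodule.Quotient.eq]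
      have : s * w - (j + s * w) = -j := by ring
      rw [this]; exact J.neg_mem hj
    · rintro ⟨s, hs⟩
      obtain ⟨s, rfl⟩ := Submodule.Quotient.mk_surjective _ s
      rw [← hs, fmk, gmk, Submodule.Quotient.mk_eq_zero]
      exact Ideal.mem_sup_right (Ideal.mul_mem_left _ _ (Ideal.mem_span_singleton_self w))
  let S : ShortComplex (ModuleCat R) := ShortComplex.mk (ModuleCat.ofHom f) (ModuleCat.ofHom g)
    (by
      rw [← ModuleCat.ofHom_comp, hfg.linearMap_comp_eq_zero]; rfl)
  have hS : S.ShortExact :=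
    { exact := (ShortComplex.ShortExact.moduleCat_exact_iff_function_exact S).mpr hfg
      mono_f := (ModuleCat.mono_iff_injective _).mpr hf
      epi_g := (ModuleCat.epi_iff_surjective _).mpr hg }
  exact hS.hasProjectiveDimensionLT_X₃ n h1 h2

end PD

section Core
variable {R : Type} [CommRing R]

/-- `p, q` only have the trivial syzygies. -/
def Reg2 (p q : R) : Prop := ∀ r s, r * p = s * q → ∃ n, r = n * q ∧ s = n * p

theorem mem_sup_sing {J : Ideal R} {w z : R} :
    z ∈ J ⊔ Ideal.span {w} ↔ ∃ n, z - n * w ∈ J := by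
  rw [Submodule.mem_sup]
  constructor
  · rintro ⟨j, hj, t, ht, rfl⟩
    obtain ⟨s, rfl⟩ := Ideal.mem_span_singleton'.mp ht
    exact ⟨s, by simpa using hj⟩
  · rintro ⟨n, hn⟩
    exact ⟨_, hn, n * w, Ideal.mul_mem_left _ _ (Ideal.mem_span_singleton_self w), by ring⟩

theorem mem_iff_mk {J : Ideal R} {z : R} : z ∈ J ↔ Ideal.Quotient.mk J z = 0 :=
  Ideal.Quotient.eq_zero_iff_mem.symm

theorem pair_eq (p q : R) : Ideal.span {p, q} = Ideal.span {p} ⊔ Ideal.span {q} := by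
  rw [Ideal.span_insert]

theorem mem_pair_left (p q : R) : p ∈ Ideal.span {p, q} := Ideal.subset_span (by simp)
theorem mem_pair_right (p q : R) : q ∈ Ideal.span {p, q} := Ideal.subset_span (by simp)

variable [IsDomain R]

theorem pd_pair {p q : R} (h : Reg2 p q) (hp : p ≠ 0) : PdLT (Ideal.span {p, q}) 3 := by
  have h1 : PdLT (⊥ ⊔ Ideal.span {p}) 2 := by
    refine pd_step (L := ⊥) p 1 (fun r => ?_) pd_bot (pd_bot.mono (by norm_num))
    simp [hp]
  rw [bot_sup_eq] at h1
  rw [pair_eq]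
  refine pd_step (L := Ideal.span {p}) q 2 (fun r => ?_) h1 (h1.mono (by norm_num))
  rw [Ideal.mem_span_singleton', Ideal.mem_span_singleton']
  constructor
  · rintro ⟨a, rfl⟩
    exact ⟨a * q, by ring⟩
  · rintro ⟨a, ha⟩
    obtain ⟨n, -, hn⟩ := h _ _ ha
    exact ⟨n, hn.symm⟩

section link
variable {p q f1 f2 c1 e1 c2 e2 : R}

theorem det_p (hf1 : f1 = c1 * p + e1 * q) (hf2 : f2 = c2 * p + e2 * q)
    : (c1 * e2 - c2 * e1) * p ∈ Ideal.span {f1, f2} :=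
  Ideal.mem_span_pair.mpr ⟨e2, -e1, by rw [hf1, hf2]; ring⟩

theorem det_q (hf1 : f1 = c1 * p + e1 * q) (hf2 : f2 = c2 * p + e2 * q)
    : (c1 * e2 - c2 * e1) * q ∈ Ideal.span {f1, f2} :=
  Ideal.mem_span_pair.mpr ⟨-c2, c1, by rw [hf1, hf2]; ring⟩

theorem link1 (hf1 : f1 = c1 * p + e1 * q) (hf2 : f2 = c2 * p + e2 * q) (hC : Reg2 f1 f2) (hf20 : f2 ≠ 0)
    (t : R) : t ∈ Ideal.span {p, q} ↔ t * (c1 * e2 - c2 * e1) ∈ Ideal.span {f1, f2} := by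
  constructor
  · intro h
    obtain ⟨α, β, rfl⟩ := Ideal.mem_span_pair.mp h
    have := Ideal.add_mem _ (Ideal.mul_mem_left _ α (det_p hf1 hf2))
      (Ideal.mul_mem_left _ β (det_q hf1 hf2))
    convert this using 1
    ring
  · intro h
    obtain ⟨r, s, hrs⟩ := Ideal.mem_span_pair.mp h
    obtain ⟨n, hn1, hn2⟩ := hC (t * e2 - p * r) (t * e1 + p * s) (by
      linear_combination -p * hrs + t * e2 * hf1 - t * e1 * hf2)
    obtain ⟨m, hm1, hm2⟩ := hC (-t * c2 - q * r) (-t * c1 + q * s) (by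
      linear_combination -q * hrs - t * c2 * hf1 + t * c1 * hf2)
    refine Ideal.mem_span_pair.mpr ⟨-m, n, ?_⟩
    apply mul_right_cancel₀ hf20
    linear_combination -q * hn1 + p * hm1 - t * hf2

theorem link2 (hf1 : f1 = c1 * p + e1 * q) (hf2 : f2 = c2 * p + e2 * q) (hC : Reg2 f1 f2) (hpq : Reg2 p q) (hp0 : p ≠ 0)
    (z : R) (hz1 : z * p ∈ Ideal.span {f1, f2}) (hz2 : z * q ∈ Ideal.span {f1, f2}) :
    z ∈ Ideal.span {f1, f2} ⊔ Ideal.span {c1 * e2 - c2 * e1} := by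
  obtain ⟨r1, r2, hr⟩ := Ideal.mem_span_pair.mp hz1
  obtain ⟨s1, s2, hs⟩ := Ideal.mem_span_pair.mp hz2
  obtain ⟨n, hn1, hn2⟩ := hC (q * r1 - p * s1) (-(q * r2 - p * s2)) (by
    linear_combination q * hr - p * hs)
  obtain ⟨m, hm1, hm2⟩ := hpq (s1 + n * c2) (r1 - n * e2) (by
    linear_combination -hn1 - n * hf2)
  obtain ⟨m', hm1', hm2'⟩ := hpq (s2 - n * c1) (r2 + n * e1) (by
    linear_combination hn2 + n * hf1)
  refine mem_sup_sing.mpr ⟨n, Ideal.mem_span_pair.mpr ⟨m, m', ?_⟩⟩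
  apply mul_right_cancel₀ hp0
  linear_combination hr - f1 * hm2 - f2 * hm2' - n * e2 * hf1 + n * e1 * hf2

theorem link_ext (hf1 : f1 = c1 * p + e1 * q) (hf2 : f2 = c2 * p + e2 * q) (hC : Reg2 f1 f2) (hf20 : f2 ≠ 0) (hpq : Reg2 p q)
    (α β : R) (h0 : q * α - p * β ∈ Ideal.span {f1, f2})
    (h1 : c1 * α + e1 * β ∈ Ideal.span {f1, f2}) (h2 : c2 * α + e2 * β ∈ Ideal.span {f1, f2}) :
    ∃ w, w * p - α ∈ Ideal.span {f1, f2} ∧ w * q - β ∈ Ideal.span {f1, f2} := by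
  obtain ⟨s, t, hst⟩ := Ideal.mem_span_pair.mp h0
  obtain ⟨g, hg1, hg2⟩ := hpq (β + s * c1 + t * c2) (α - s * e1 - t * e2) (by
    linear_combination hst - s * hf1 - t * hf2)
  have hF1 : f1 ∈ Ideal.span {f1, f2} := mem_pair_left _ _
  have hF2 : f2 ∈ Ideal.span {f1, f2} := mem_pair_right _ _
  have hα : α = s * e1 + t * e2 + g * p := by linear_combination hg2
  have hβ : β = -(s * c1) - t * c2 + g * q := by linear_combination hg1
  have ht : t ∈ Ideal.span {p, q} := by
    rw [link1 hf1 hf2 hC hf20]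
    have := Ideal.sub_mem _ h1 (Ideal.mul_mem_left _ g hF1)
    convert this using 1
    rw [hα, hβ, hf1]; ring
  have hs : s ∈ Ideal.span {p, q} := by
    rw [link1 hf1 hf2 hC hf20]
    have := Ideal.sub_mem _ (Ideal.mul_mem_left _ g hF2) h2
    convert this using 1
    rw [hα, hβ, hf2]; ring
  obtain ⟨s1, s2, hs⟩ := Ideal.mem_span_pair.mp hs
  obtain ⟨t1, t2, ht⟩ := Ideal.mem_span_pair.mp ht
  refine ⟨g + s1 * e1 - s2 * c1 + t1 * e2 - t2 * c2, ?_, ?_⟩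
  · refine Ideal.mem_span_pair.mpr ⟨-s2, -t2, ?_⟩
    rw [hα, ← hs, ← ht, hf1, hf2]; ring
  · refine Ideal.mem_span_pair.mpr ⟨s1, t1, ?_⟩
    rw [hβ, ← hs, ← ht, hf1, hf2]; ring

end link

/-- `a, b` is a regular sequence modulo `I` (in the weak sense). -/
def RegMod (I : Ideal R) (a b : R) : Prop :=
  ∀ α β, a * α + b * β ∈ I → ∃ c, α - b * c ∈ I ∧ β + a * c ∈ I

theorem core {x y u a b f1 f2 c1 e1 c2 e2 : R}
    (hf1 : f1 = c1 * x + e1 * (u * y)) (hf2 : f2 = c2 * x + e2 * (u * y))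
    (hC : Reg2 f1 f2) (hf20 : f2 ≠ 0)
    (hxy : Reg2 x y) (hxq : Reg2 x (u * y)) (hx0 : x ≠ 0)
    (hprime : (Ideal.span {x, y}).IsPrime)
    (hab : RegMod (Ideal.span {x, y}) a b)
    (h1 : c1 * b - e1 * a ∈ Ideal.span {x, y}) (h2 : c2 * b - e2 * a ∈ Ideal.span {x, y}) :
    ∃ w, (∀ z, (∀ c e, c * b - e * a ∈ Ideal.span {x, y} →
          z * (c * x + e * (u * y)) ∈ Ideal.span {f1, f2}) ↔
          z ∈ Ideal.span {f1, f2} ⊔ Ideal.span {c1 * e2 - c2 * e1} ⊔ Ideal.span {w}) ∧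
      (∀ c, c ∈ Ideal.span {x, y} ↔
        c * w ∈ Ideal.span {f1, f2} ⊔ Ideal.span {c1 * e2 - c2 * e1}) := by
  set C := Ideal.span {f1, f2} with hCdef
  set P := Ideal.span {x, y} with hPdef
  set D := c1 * e2 - c2 * e1 with hD
  have hf1' : f1 = c1 * x + (e1 * u) * y := by rw [hf1]; ring
  have hf2' : f2 = c2 * x + (e2 * u) * y := by rw [hf2]; ring
  have hdel : c1 * (e2 * u) - c2 * (e1 * u) = u * D := by rw [hD]; ring
  -- `δ = u * D`
  have hδ : ∀ t, t ∈ P ↔ t * (u * D) ∈ C := by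
    intro t
    have := link1 hf1' hf2' hC hf20 t
    rwa [hdel] at this
  have hD1 : ∀ t, t ∈ Ideal.span {x, u * y} ↔ t * D ∈ C := link1 hf1 hf2 hC hf20
  have hxP : x ∈ P := mem_pair_left _ _
  have hyP : y ∈ P := mem_pair_right _ _
  -- existence of w
  obtain ⟨w, hw1, hw2⟩ := link_ext hf1 hf2 hC hf20 hxq (b * (u * D)) (-a * (u * D))
    (by
      have := (hδ (u * y * b + x * a)).mp
        (P.add_mem (P.mul_mem_right _ (P.mul_mem_left _ hyP)) (P.mul_mem_right _ hxP))
      convert this using 1; ring)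
    (by
      have := (hδ _).mp h1
      convert this using 1; ring)
    (by
      have := (hδ _).mp h2
      convert this using 1; ring)
  have hyw : ∀ c ∈ P, c * w ∈ C ⊔ Ideal.span {D} := by
    intro c hc
    refine link2 hf1 hf2 hC hxq hx0 _ ?_ ?_
    · have := C.add_mem (C.mul_mem_left c hw1) (C.mul_mem_left b ((hδ c).mp hc))
      convert this using 1; ring
    · have := C.sub_mem (C.mul_mem_left c hw2) (C.mul_mem_left a ((hδ c).mp hc))
      convert this using 1; ring
  have hDx : D * x ∈ C := det_p hf1 hf2
  have hDq : D * (u * y) ∈ C := det_q hf1 hf2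
  refine ⟨w, fun z => ⟨fun hz => ?_, fun hz => ?_⟩, fun c => ⟨hyw c, fun hc => ?_⟩⟩
  · -- z ∈ C : J
    have key : ∀ c e, c ∈ P → e ∈ P → z * (c * x + e * (u * y)) ∈ C := fun c e hc he =>
      hz c e (P.sub_mem (P.mul_mem_right _ hc) (P.mul_mem_right _ he))
    have hzx : z * x ∈ C ⊔ Ideal.span {u * D} := by
      rw [← hdel]
      refine link2 hf1' hf2' hC hxy hx0 _ ?_ ?_
      · have := key x 0 hxP P.zero_mem
        convert this using 1; ring
      · have := key y 0 hyP P.zero_mem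
        convert this using 1; ring
    have hzq : z * (u * y) ∈ C ⊔ Ideal.span {u * D} := by
      rw [← hdel]
      refine link2 hf1' hf2' hC hxy hx0 _ ?_ ?_
      · have := key 0 x P.zero_mem hxP
        convert this using 1; ring
      · have := key 0 y P.zero_mem hyP
        convert this using 1; ring
    obtain ⟨α, hα⟩ := mem_sup_sing.mp hzx
    obtain ⟨β, hβ⟩ := mem_sup_sing.mp hzq
    have hh := hz a b (by rw [mul_comm a b, sub_self]; exact P.zero_mem)
    have hαβ : a * α + b * β ∈ P := by
      rw [hδ]
      have := C.sub_mem hh (C.add_mem (C.mul_mem_left a hα) (C.mul_mem_left b hβ))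
      convert this using 1; ring
    obtain ⟨c, hc1, hc2⟩ := hab α β hαβ
    have e1 : (z - c * w) * x ∈ C := by
      have := C.sub_mem (C.add_mem hα ((hδ _).mp hc1)) (C.mul_mem_left c hw1)
      convert this using 1; ring
    have e2 : (z - c * w) * (u * y) ∈ C := by
      have := C.sub_mem (C.add_mem hβ ((hδ _).mp hc2)) (C.mul_mem_left c hw2)
      convert this using 1; ring
    exact mem_sup_sing.mpr ⟨c, link2 hf1 hf2 hC hxq hx0 _ e1 e2⟩
  · intro c e hce
    obtain ⟨m, hm⟩ := mem_sup_sing.mp hz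
    obtain ⟨n, hn⟩ := mem_sup_sing.mp hm
    have t1 := C.mul_mem_right (c * x + e * (u * y)) hn
    have t2 := C.mul_mem_left m (C.add_mem (C.mul_mem_left c hw1) (C.mul_mem_left e hw2))
    have t3 := C.mul_mem_left m ((hδ _).mp hce)
    have t4 := C.mul_mem_left n (C.add_mem (C.mul_mem_left c hDx) (C.mul_mem_left e hDq))
    have := C.add_mem (C.add_mem t1 t2) (C.add_mem t3 t4)
    convert this using 1; ring
  · obtain ⟨n, hn⟩ := mem_sup_sing.mp hc
    have hcb : c * b ∈ P := by
      rw [hδ]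
      have := C.sub_mem (C.add_mem (C.mul_mem_right x hn) (C.mul_mem_left n hDx))
        (C.mul_mem_left c hw1)
      convert this using 1; ring
    have hca : c * a ∈ P := by
      rw [hδ]
      have := C.sub_mem (C.mul_mem_left c hw2)
        (C.add_mem (C.mul_mem_right (u * y) hn) (C.mul_mem_left n hDq))
      convert this using 1; ring
    by_contra hcP
    have ha := (hprime.mem_or_mem hca).resolve_left hcP
    have hb := (hprime.mem_or_mem hcb).resolve_left hcP
    obtain ⟨m, hm, -⟩ := hab 1 0 (P.add_mem (P.mul_mem_right _ ha) (P.mul_mem_right _ hb))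
    apply hprime.ne_top
    rw [Ideal.eq_top_iff_one]
    have := P.add_mem hm (P.mul_mem_right m hb)
    convert this using 1; ring

/-- The case of linkage through `(x, u*y)`. -/
theorem pd_case3 {x y u a b f1 f2 c1 e1 c2 e2 : R} {L : Ideal R}
    (hf1 : f1 = c1 * x + e1 * (u * y)) (hf2 : f2 = c2 * x + e2 * (u * y))
    (hC : Reg2 f1 f2) (hf10 : f1 ≠ 0) (hf20 : f2 ≠ 0)
    (hxy : Reg2 x y) (hxq : Reg2 x (u * y)) (hx0 : x ≠ 0)
    (hprime : (Ideal.span {x, y}).IsPrime)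
    (hab : RegMod (Ideal.span {x, y}) a b)
    (h1 : c1 * b - e1 * a ∈ Ideal.span {x, y}) (h2 : c2 * b - e2 * a ∈ Ideal.span {x, y})
    (hL : ∀ z, z ∈ L ↔ (∀ c e, c * b - e * a ∈ Ideal.span {x, y} →
          z * (c * x + e * (u * y)) ∈ Ideal.span {f1, f2})) :
    PdLT L 4 := by
  obtain ⟨w, hw, hw2⟩ := core hf1 hf2 hC hf20 hxy hxq hx0 hprime hab h1 h2
  have : L = Ideal.span {f1, f2} ⊔ Ideal.span {c1 * e2 - c2 * e1} ⊔ Ideal.span {w} := by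
    ext z; rw [hL, hw]
  rw [this]
  have hc := pd_pair hC hf10
  have s1 : PdLT (Ideal.span {f1, f2} ⊔ Ideal.span {c1 * e2 - c2 * e1}) 4 :=
    pd_step _ 3 (link1 hf1 hf2 hC hf20) (pd_pair hxq hx0) (hc.mono (by norm_num))
  exact pd_step _ 3 hw2 (pd_pair hxy hx0) s1

/-- The case where `x, y, u, v` is a regular sequence. -/
theorem pd_case4 {x y u v a b f1 f2 c1 e1 c2 e2 c1' e1' c2' e2' : R} {L K : Ideal R}
    (hf1 : f1 = c1 * x + e1 * y) (hf2 : f2 = c2 * x + e2 * y)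
    (hf1' : f1 = c1' * u + e1' * v) (hf2' : f2 = c2' * u + e2' * v)
    (hC : Reg2 f1 f2) (hf10 : f1 ≠ 0) (hf20 : f2 ≠ 0)
    (hxy : Reg2 x y) (huv : Reg2 u v) (hx0 : x ≠ 0) (hu0 : u ≠ 0)
    (hprime : (Ideal.span {x, y}).IsPrime)
    (hab : RegMod (Ideal.span {x, y}) a b)
    (h1 : c1 * b - e1 * a ∈ Ideal.span {x, y}) (h2 : c2 * b - e2 * a ∈ Ideal.span {x, y})
    (hu : u ∉ Ideal.span {x, y})
    (huvP : ∀ r s, r * v - s * u ∈ Ideal.span {x, y} → ∃ t, r - t * u ∈ Ideal.span {x, y})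
    (hK : ∀ z, z ∈ K ↔ ∃ c e, c * b - e * a ∈ Ideal.span {x, y} ∧ z = c * x + e * y)
    (hL : ∀ z, z ∈ L ↔ ∀ j ∈ K ⊓ Ideal.span {u, v}, z * j ∈ Ideal.span {f1, f2}) :
    PdLT L 4 := by
  obtain ⟨w, hw, hw2⟩ := core (u := 1) (by rw [hf1, one_mul]) (by rw [hf2, one_mul]) hC hf20 hxy
    (by rwa [one_mul]) hx0 hprime hab h1 h2
  set C := Ideal.span {f1, f2} with hCdef
  set P := Ideal.span {x, y} with hPdef
  set T := Ideal.span {u, v} with hTdef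
  set D := c1 * e2 - c2 * e1 with hD
  set D' := c1' * e2' - c2' * e1' with hD'
  have huT : u ∈ T := mem_pair_left _ _
  have hvT : v ∈ T := mem_pair_right _ _
  have hDl : ∀ t, t ∈ P ↔ t * D ∈ C := link1 hf1 hf2 hC hf20
  have hDl' : ∀ t, t ∈ T ↔ t * D' ∈ C := link1 hf1' hf2' hC hf20
  have uP : ∀ c, u * c ∈ P → c ∈ P := fun c h => (hprime.mem_or_mem h).resolve_left hu
  set W := C ⊔ Ideal.span {D} ⊔ Ideal.span {w} with hW
  have hWK : ∀ z, z ∈ W ↔ ∀ j ∈ K, z * j ∈ C := by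
    intro z
    rw [← hw]
    constructor
    · intro h j hj
      obtain ⟨c, e, hce, rfl⟩ := (hK j).mp hj
      have := h c e hce
      rwa [one_mul] at this
    · intro h c e hce
      rw [one_mul]
      exact h _ ((hK _).mpr ⟨c, e, hce, rfl⟩)
  have hCW : C ≤ W := le_sup_left.trans le_sup_left
  have hDW : D ∈ W := Ideal.mem_sup_left (Ideal.mem_sup_right (Ideal.mem_span_singleton_self _))
  have hwW : w ∈ W := Ideal.mem_sup_right (Ideal.mem_span_singleton_self _)
  -- `u` is a nonzerodivisor on `W / (C + D)` and on `W / C`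
  have nz1 : ∀ z ∈ W, u * z ∈ C ⊔ Ideal.span {D} → z ∈ C ⊔ Ideal.span {D} := by
    intro z hz huz
    obtain ⟨c, hc⟩ := mem_sup_sing.mp hz
    have : u * c ∈ P := by
      rw [hw2]
      have := Ideal.sub_mem _ huz (Ideal.mul_mem_left _ u hc)
      convert this using 1; ring
    have := Ideal.add_mem _ hc ((hw2 _).mp (uP _ this))
    convert this using 1; ring
  have nz0 : ∀ z ∈ C ⊔ Ideal.span {D}, u * z ∈ C → z ∈ C := by
    intro z hz huz
    obtain ⟨c, hc⟩ := mem_sup_sing.mp hz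
    have : u * c ∈ P := by
      rw [hDl]
      have := Ideal.sub_mem _ huz (Ideal.mul_mem_left _ u hc)
      convert this using 1; ring
    have := Ideal.add_mem _ hc ((hDl _).mp (uP _ this))
    convert this using 1; ring
  have nz : ∀ z ∈ W, u * z ∈ C → z ∈ C := fun z hz huz =>
    nz0 z (nz1 z hz (Ideal.mem_sup_left huz)) huz
  have hLeq : L = C ⊔ Ideal.span {D'} ⊔ Ideal.span {D} ⊔ Ideal.span {w} := by
    apply le_antisymm
    · intro z hz
      have hz := (hL z).mp hz
      have zt : ∀ t ∈ T, z * t ∈ W := by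
        intro t ht
        rw [hWK]
        intro j hj
        have := hz (t * j) ⟨K.mul_mem_left _ hj, T.mul_mem_right _ ht⟩
        convert this using 1; ring
      have zu := zt u huT
      have zv := zt v hvT
      obtain ⟨c, hc⟩ := mem_sup_sing.mp zu
      obtain ⟨c', hc'⟩ := mem_sup_sing.mp zv
      have hcc : c * v - c' * u ∈ P := by
        rw [hw2]
        have := Ideal.sub_mem _ (Ideal.mul_mem_left _ u hc') (Ideal.mul_mem_left _ v hc)
        convert this using 1; ring
      obtain ⟨t, ht⟩ := huvP _ _ hcc
      have e1 : z * u - t * u * w ∈ C ⊔ Ideal.span {D} := by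
        have := Ideal.add_mem _ hc ((hw2 _).mp ht)
        convert this using 1; ring
      have e2 : z * v - t * v * w ∈ C ⊔ Ideal.span {D} := by
        apply nz1
        · have := W.sub_mem zv (W.mul_mem_left (t * v) hwW)
          convert this using 1
        · have := Ideal.mul_mem_left _ v e1
          convert this using 1; ring
      obtain ⟨n, hn⟩ := mem_sup_sing.mp e1
      obtain ⟨n', hn'⟩ := mem_sup_sing.mp e2
      have hnn : n * v - n' * u ∈ P := by
        rw [hDl]
        have := Ideal.sub_mem _ (Ideal.mul_mem_left _ u hn') (Ideal.mul_mem_left _ v hn)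
        convert this using 1; ring
      obtain ⟨t', ht'⟩ := huvP _ _ hnn
      have e3 : (z - t * w - t' * D) * u ∈ C := by
        have := Ideal.add_mem _ hn ((hDl _).mp ht')
        convert this using 1; ring
      have e4 : (z - t * w - t' * D) * v ∈ C := by
        apply nz
        · have := W.sub_mem (W.sub_mem zv (W.mul_mem_left (t * v) hwW))
            (W.mul_mem_left (t' * v) hDW)
          convert this using 1; ring
        · have := C.mul_mem_left v e3
          convert this using 1; ring
      have := link2 hf1' hf2' hC huv hu0 _ e3 e4
      exact mem_sup_sing.mpr ⟨t, mem_sup_sing.mpr ⟨t', this⟩⟩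
    · have hWL : W ≤ L := fun z hz => (hL z).mpr fun j hj => (hWK z).mp hz j hj.1
      refine sup_le (sup_le (sup_le (hCW.trans hWL) ?_) ?_) ?_
      · rw [Ideal.span_singleton_le_iff_mem, hL]
        intro j hj
        have := (hDl' j).mp hj.2
        rwa [mul_comm]
      · rw [Ideal.span_singleton_le_iff_mem]; exact hWL hDW
      · rw [Ideal.span_singleton_le_iff_mem]; exact hWL hwW
  rw [hLeq]
  have hc := pd_pair hC hf10
  have s1 : PdLT (C ⊔ Ideal.span {D'}) 4 :=
    pd_step _ 3 hDl' (pd_pair huv hu0) (hc.mono (by norm_num))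
  have hD'u : u * D' ∈ C := (hDl' u).mp huT
  have s2 : PdLT (C ⊔ Ideal.span {D'} ⊔ Ideal.span {D}) 4 := by
    refine pd_step _ 3 (L := P) (fun r => ⟨fun h => ?_, fun h => ?_⟩) (pd_pair hxy hx0) s1
    · exact Ideal.mem_sup_left ((hDl r).mp h)
    · obtain ⟨m, hm⟩ := mem_sup_sing.mp h
      apply uP
      rw [hDl]
      have := C.add_mem (C.mul_mem_left u hm) (C.mul_mem_left m hD'u)
      convert this using 1; ring
  refine pd_step _ 3 (L := P) (fun r => ⟨fun h => ?_, fun h => ?_⟩) (pd_pair hxy hx0) s2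
  · have := (hw2 r).mp h
    refine (sup_le_sup_right le_sup_left _ : C ⊔ Ideal.span {D} ≤ _) this
  · obtain ⟨n, hn⟩ := mem_sup_sing.mp h
    obtain ⟨m, hm⟩ := mem_sup_sing.mp hn
    apply uP
    rw [hw2]
    refine mem_sup_sing.mpr ⟨u * n, ?_⟩
    have := C.add_mem (C.mul_mem_left u hm) (C.mul_mem_left m hD'u)
    convert this using 1; ring

end Core

section Nagata
open Polynomial MvPolynomial Ideal Nat RingHom List

variable {k : Type*} [Field k] {n : ℕ} (f : MvPolynomial (Fin (n + 1)) k)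
variable (v w : Fin (n + 1) →₀ ℕ)



lemma lt_up (vlt : ∀ i, v i < (2 + f.totalDegree)) : ∀ l ∈ ofFn v, l < (2 + f.totalDegree) := by
  grind


/-- We construct an algebra map `NagT1 f c` which maps `X_i` into `X_i + c • X_0 ^ r_i` when `i ≠ 0`
and `X_0` to `X_0`. -/
abbrev NagT1 (c : k) :
    MvPolynomial (Fin (n + 1)) k →ₐ[k] MvPolynomial (Fin (n + 1)) k :=
  aeval fun i ↦ if i = 0 then X 0 else X i + c • X 0 ^ (2 + f.totalDegree) ^ i.1

lemma t1_comp_t1_neg (c : k) : (NagT1 f c).comp (NagT1 f (-c)) = AlgHom.id _ _ := by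
  rw [comp_aeval, ← MvPolynomial.aeval_X_left]
  ext i v
  cases i using Fin.cases <;> simp

/-- `NagT1 f 1` leads to an algebra equiv `NagT f`. -/
abbrev NagT := AlgEquiv.ofAlgHom (NagT1 f 1) (NagT1 f (-1))
  (t1_comp_t1_neg f 1) (by simpa using t1_comp_t1_neg f (-1))

lemma sum_r_mul_ne (vlt : ∀ i, v i < (2 + f.totalDegree)) (wlt : ∀ i, w i < (2 + f.totalDegree)) (ne : v ≠ w) :
    ∑ x : Fin (n + 1), (2 + f.totalDegree) ^ x.1 * v x ≠ ∑ x : Fin (n + 1), (2 + f.totalDegree) ^ x.1 * w x := by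
  intro h
  refine ne <| Finsupp.ext <| congrFun <| ofFn_inj.mp ?_
  apply ofDigits_inj_of_len_eq (Nat.lt_add_right f.totalDegree one_lt_two)
    (by simp) (lt_up f v vlt) (lt_up f w wlt)
  simpa only [ofDigits_eq_sum_mapIdx, mapIdx_eq_ofFn, get_ofFn, length_ofFn,
    Fin.val_cast, mul_comm, sum_ofFn] using! h

lemma degreeOf_zero_t {a : k} (ha : a ≠ 0) : ((NagT f) (monomial v a)).degreeOf 0 =
    ∑ i : Fin (n + 1), ((2 + f.totalDegree) ^ i.1) * v i := by
  rw [← natDegree_finSuccEquiv, monomial_eq, Finsupp.prod_pow v fun a ↦ X a]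
  simp only [Fin.prod_univ_succ, Fin.sum_univ_succ, map_mul, map_prod, map_pow,
    AlgEquiv.ofAlgHom_apply, MvPolynomial.aeval_C, MvPolynomial.aeval_X, if_pos, Fin.succ_ne_zero,
    ite_false, one_smul, map_add, finSuccEquiv_X_zero, finSuccEquiv_X_succ, algebraMap_eq]
  have h (i : Fin n) :
      (Polynomial.C (X (R := k) i) + Polynomial.X ^ (2 + f.totalDegree) ^ (Fin.succ i).1) ^ v i.succ ≠ 0 :=
    pow_ne_zero (v i.succ) (leadingCoeff_ne_zero.mp <| by simp [add_comm, leadingCoeff_X_pow_add_C])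
  rw [natDegree_mul (by simp [ha]) (mul_ne_zero (by simp) (Finset.prod_ne_zero_iff.mpr
    (fun i _ ↦ h i))), natDegree_mul (by simp) (Finset.prod_ne_zero_iff.mpr (fun i _ ↦ h i)),
    natDegree_prod _ _ (fun i _ ↦ h i), natDegree_finSuccEquiv, degreeOf_C]
  simpa only [natDegree_pow, zero_add, natDegree_X, mul_one, Fin.val_zero, pow_zero, one_mul,
    add_right_inj] using Finset.sum_congr rfl (fun i _ ↦ by
    rw [add_comm (Polynomial.C _), natDegree_X_pow_add_C, mul_comm])

/-- `T` maps different monomials of `f` to polynomials with different degrees in `X_0`. -/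
lemma degreeOf_t_ne_of_ne (hv : v ∈ f.support) (hw : w ∈ f.support) (ne : v ≠ w) :
    (NagT f <| monomial v <| coeff v f).degreeOf 0 ≠
    (NagT f <| monomial w <| coeff w f).degreeOf 0 := by
  rw [degreeOf_zero_t _ _ <| mem_support_iff.mp hv, degreeOf_zero_t _ _ <| mem_support_iff.mp hw]
  refine sum_r_mul_ne f v w (fun i ↦ ?_) (fun i ↦ ?_) ne <;>
  exact lt_of_le_of_lt ((monomial_le_degreeOf i ‹_›).trans (degreeOf_le_totalDegree f i))
    (by lia)

lemma leadingCoeff_finSuccEquiv_t :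
    (finSuccEquiv k n ((NagT f) ((monomial v) (coeff v f)))).leadingCoeff =
    algebraMap k _ (coeff v f) := by
  rw [monomial_eq, Finsupp.prod_fintype]
  · simp only [map_mul, map_prod, leadingCoeff_mul, leadingCoeff_prod]
    rw [AlgEquiv.ofAlgHom_apply, algHom_C, algebraMap_eq, finSuccEquiv_apply,
      eval₂Hom_C, coe_comp]
    simp only [AlgEquiv.ofAlgHom_apply, Function.comp_apply, leadingCoeff_C, map_pow,
      leadingCoeff_pow, algebraMap_eq]
    have : ∀ j, ((finSuccEquiv k n) ((NagT1 f) 1 (X j))).leadingCoeff = 1 := fun j ↦ by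
      by_cases h : j = 0
      · simp [h, finSuccEquiv_apply]
      · simp only [aeval_eq_bind₁, bind₁_X_right, if_neg h, one_smul, map_add, map_pow]
        obtain ⟨i, rfl⟩ := Fin.exists_succ_eq.mpr h
        simp [finSuccEquiv_X_succ, finSuccEquiv_X_zero, add_comm]
    simp only [this, one_pow, Finset.prod_const_one, mul_one]
  exact fun i ↦ pow_zero _

/-- `T` maps `f` into some polynomial in `X_0` such that the leading coefficient is invertible. -/
lemma T_leadingcoeff_isUnit (fne : f ≠ 0) :
    IsUnit (finSuccEquiv k n (NagT f f)).leadingCoeff := by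
  obtain ⟨v, vin, vs⟩ := Finset.exists_max_image f.support
    (fun v ↦ (NagT f ((monomial v) (coeff v f))).degreeOf 0) (support_nonempty.mpr fne)
  set h := fun w ↦ (MvPolynomial.monomial w) (coeff w f)
  simp only [← natDegree_finSuccEquiv] at vs
  replace vs : ∀ x ∈ f.support \ {v}, (finSuccEquiv k n ((NagT f) (h x))).degree <
      (finSuccEquiv k n ((NagT f) (h v))).degree := by
    intro x hx
    obtain ⟨h1, h2⟩ := Finset.mem_sdiff.mp hx
    apply degree_lt_degree <| lt_of_le_of_ne (vs x h1) ?_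
    simpa only [natDegree_finSuccEquiv]
      using degreeOf_t_ne_of_ne f _ _ h1 vin <| ne_of_not_mem_cons h2
  have coeff : (finSuccEquiv k n ((NagT f) (h v + ∑ x ∈ f.support \ {v}, h x))).leadingCoeff =
      (finSuccEquiv k n ((NagT f) (h v))).leadingCoeff := by
    simp only [map_add, map_sum]
    rw [add_comm]
    apply leadingCoeff_add_of_degree_lt <| (lt_of_le_of_lt <| degree_sum_le _ _) ?_
    have h2 : h v ≠ 0 := by simpa [h] using mem_support_iff.mp vin
    replace h2 : (finSuccEquiv k n ((NagT f) (h v))) ≠ 0 := fun eq ↦ h2 <|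
      by simpa only [map_eq_zero_iff _ (AlgEquiv.injective _)] using eq
    exact (Finset.sup_lt_iff <| Ne.bot_lt (fun x ↦ h2 <| degree_eq_bot.mp x)).mpr vs
  nth_rw 2 [← f.support_sum_monomial_coeff]
  rw [Finset.sum_eq_add_sum_sdiff_singleton_of_mem vin h]
  rw [leadingCoeff_finSuccEquiv_t] at coeff
  simpa only [coeff, algebraMap_eq] using (mem_support_iff.mp vin).isUnit.map MvPolynomial.C

end Nagata

section Unmixed
open Polynomial

theorem poly_red {B : Type} [CommRing B] [IsDomain B] {f : B[X]} (hf : f.Monic) {c : B} (hc : c ≠ 0)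
    {h : B[X]} (H : f ∣ Polynomial.C c * h) : f ∣ h := by
  rw [← modByMonic_eq_zero_iff_dvd hf] at H ⊢
  rw [← Polynomial.smul_eq_C_mul, smul_modByMonic] at H
  exact (smul_eq_zero.mp H).resolve_left hc

theorem unmixed_i {B : Type} [CommRing B] [IsDomain B] [IsNoetherianRing B]
    (f : B[X]) (hf : f.Monic) (bb : Ideal B[X]) (hfb : f ∈ bb)
    (H : ∀ P : Ideal B[X], P.IsPrime → bb ≤ P → 2 < P.height)
    (π : B) (hπ : (Ideal.span {π}).IsPrime) : ∃ c, Polynomial.C c ∈ bb ∧ c ∉ Ideal.span {π} := by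
  by_contra! hcon
  let E := B[X] ⧸ Ideal.span {f}
  let q : B[X] →+* E := Ideal.Quotient.mk (Ideal.span {f})
  have hq : Function.Surjective q := Ideal.Quotient.mk_surjective
  have hker : RingHom.ker q = Ideal.span {f} := Ideal.mk_ker
  have hintg : Algebra.IsIntegral B E := by
    constructor
    exact hf.quotient_isIntegral (Ideal.mem_span_singleton_self f)
  have halg : ∀ c, algebraMap B E c = q (Polynomial.C c) := fun c => rfl
  have hcm : ∀ I : Ideal B[X], f ∈ I → (I.map q).comap q = I := by
    intro I hI
    rw [Ideal.comap_map_of_surjective' q hq, hker, sup_eq_left]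
    simpa [Ideal.span_le] using hI
  have h1 : (bb.map q).comap (algebraMap B E) ≤ Ideal.span {π} := by
    intro c hc
    apply hcon
    rw [Ideal.mem_comap, halg, ← Ideal.mem_comap, hcm _ hfb] at hc
    exact hc
  obtain ⟨Q, hQ1, hQ2, hQ3⟩ := Ideal.exists_ideal_over_prime_of_isIntegral _ _ h1
  have hP : (Q.comap q).IsPrime := inferInstance
  have hbP : bb ≤ Q.comap q := Ideal.map_le_iff_le_comap.mp hQ1
  have hmin : Q.comap q ∈ (Ideal.span ({Polynomial.C π, f} : Set B[X])).minimalPrimes := by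
    refine ⟨⟨hP, ?_⟩, ?_⟩
    · rw [Ideal.span_le]
      rintro z (rfl | rfl)
      · have : π ∈ Q.comap (algebraMap B E) := by rw [hQ3]; exact Ideal.mem_span_singleton_self π
        exact this
      · exact hbP hfb
    · rintro P' ⟨hP', hle⟩ hP'Q
      have hfP' : f ∈ P' := hle (Ideal.subset_span (by simp))
      have hpP' : Polynomial.C π ∈ P' := hle (Ideal.subset_span (by simp))
      have hpr : (P'.map q).IsPrime := Ideal.map_isPrime_of_surjective hq (by
        rw [hker]; simpa [Ideal.span_le] using hfP')
      have hle2 : P'.map q ≤ Q := Ideal.map_le_iff_le_comap.mpr hP'Q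
      have : Q ≤ P'.map q := by
        by_contra hn
        obtain ⟨z, hz1, hz2⟩ := Set.not_subset.mp hn
        have := Ideal.comap_lt_comap_of_integral_mem_sdiff (R := B) hle2 ⟨hz1, hz2⟩
          (Algebra.IsIntegral.isIntegral z)
        rw [hQ3] at this
        apply this.not_ge
        rw [Ideal.span_singleton_le_iff_mem, Ideal.mem_comap, halg]
        exact Ideal.mem_map_of_mem _ hpP'
      rw [← hcm P' hfP']
      exact Ideal.comap_mono this
  have h2 := Ideal.height_le_card_of_mem_minimalPrimes_span (by simp) hmin
  have h3 : (({Polynomial.C π, f} : Set B[X]).ncard : ℕ∞) ≤ 2 := by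
    exact_mod_cast Set.ncard_insert_le _ _ |>.trans (by simp)
  exact absurd (H _ hP hbP) (not_lt.mpr (h2.trans h3))

theorem unmixed_poly {B : Type} [CommRing B] [IsDomain B] [UniqueFactorizationMonoid B]
    [IsNoetherianRing B] (f g z : B[X]) (hf : f.Monic) (hg : ∀ h, f ∣ g * h → f ∣ h)
    (H : ∀ P : Ideal B[X], P.IsPrime → (∀ r, r * z ∈ Ideal.span {f, g} → r ∈ P) → 2 < P.height) :
    z ∈ Ideal.span {f, g} := by
  let bb : Ideal B[X] := (Ideal.span {f, g}).colon {z}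
  have hbb : ∀ r, r ∈ bb ↔ r * z ∈ Ideal.span {f, g} := fun r => by
    simp [bb, Submodule.mem_colon_singleton]
  have hfb : f ∈ bb := (hbb _).mpr (Ideal.mul_mem_right _ _ (Ideal.subset_span (by simp)))
  have H' : ∀ P : Ideal B[X], P.IsPrime → bb ≤ P → 2 < P.height := fun P h1 h2 =>
    H P h1 fun r hr => h2 ((hbb r).mpr hr)
  have hi := unmixed_i f hf bb hfb H'
  have hmem : ∀ w : B[X], w ∈ Ideal.span {f, g} ↔ ∃ e, f ∣ w - g * e ∧ e %ₘ f = e := by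
    intro w
    rw [Ideal.mem_span_pair]
    constructor
    · rintro ⟨s, t, rfl⟩
      refine ⟨t %ₘ f, ⟨s + g * (t /ₘ f), ?_⟩, ?_⟩
      · have := modByMonic_add_div t f
        linear_combination -g * this
      · rw [modByMonic_eq_self_iff hf]; exact degree_modByMonic_lt _ hf
    · rintro ⟨e, ⟨s, hs⟩, -⟩
      exact ⟨s, e, by linear_combination -hs⟩
  have key : ∀ c : B, c ≠ 0 → Polynomial.C c ∈ bb → z ∈ Ideal.span {f, g} := by
    intro c
    induction c using UniqueFactorizationMonoid.induction_on_prime with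
    | h₁ => intro h; exact absurd rfl h
    | h₂ c hc =>
      intro _ h
      have := (hbb _).mp h
      rwa [mul_comm, Ideal.mul_unit_mem_iff_mem _ (hc.map Polynomial.C)] at this
    | h₃ c' π hc' hπ ih =>
      intro h0 hc
      refine ih hc' ?_
      obtain ⟨c2, hc2, hπc2⟩ := hi π ((Ideal.span_singleton_prime hπ.ne_zero).mpr hπ)
      rw [Ideal.mem_span_singleton] at hπc2
      obtain ⟨e1, he1, hr1⟩ := (hmem _).mp ((hbb _).mp hc)
      obtain ⟨e2, he2, hr2⟩ := (hmem _).mp ((hbb _).mp hc2)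
      have hd : f ∣ Polynomial.C c2 * e1 - Polynomial.C (π * c') * e2 := by
        apply hg
        have := dvd_sub (he2.mul_left (Polynomial.C (π * c'))) (he1.mul_left (Polynomial.C c2))
        convert this using 1; ring
      have heq : Polynomial.C c2 * e1 - Polynomial.C (π * c') * e2 = 0 := by
        rw [← modByMonic_eq_zero_iff_dvd hf] at hd
        rwa [← Polynomial.smul_eq_C_mul, ← Polynomial.smul_eq_C_mul, sub_modByMonic, smul_modByMonic, smul_modByMonic,
          hr1, hr2, Polynomial.smul_eq_C_mul, Polynomial.smul_eq_C_mul] at hd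
      have hdiv : Polynomial.C π ∣ e1 := by
        rw [Polynomial.C_dvd_iff_dvd_coeff]
        intro i
        have := congrArg (fun w => Polynomial.coeff w i) heq
        simp only [Polynomial.coeff_sub, Polynomial.coeff_C_mul, Polynomial.coeff_zero] at this
        refine (hπ.dvd_or_dvd (a := c2) ⟨c' * e2.coeff i, ?_⟩).resolve_left hπc2
        linear_combination this
      obtain ⟨e', rfl⟩ := hdiv
      have : f ∣ Polynomial.C c' * z - g * e' := by
        apply poly_red hf hπ.ne_zero
        convert he1 using 1
        rw [Polynomial.C_mul]; ring
      rw [hbb]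
      obtain ⟨s, hs⟩ := this
      exact Ideal.mem_span_pair.mpr ⟨s, e', by linear_combination -hs⟩
  obtain ⟨c, hc, hc0⟩ := hi 0 (by simpa using Ideal.isPrime_bot)
  exact key c (by simpa using hc0) hc

theorem unmixed_mv {k : Type} [Field k] {n : ℕ} (f g z : MvPolynomial (Fin (n + 1)) k)
    (hf : f ≠ 0) (hg : ∀ h, f ∣ g * h → f ∣ h)
    (H : ∀ P : Ideal (MvPolynomial (Fin (n + 1)) k), P.IsPrime →
      (∀ r, r * z ∈ Ideal.span {f, g} → r ∈ P) → 2 < P.height) :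
    z ∈ Ideal.span {f, g} := by
  let e : MvPolynomial (Fin (n + 1)) k ≃+* (MvPolynomial (Fin n) k)[X] :=
    ((NagT f).trans (MvPolynomial.finSuccEquiv k n)).toRingEquiv
  have hu : IsUnit (e f).leadingCoeff := T_leadingcoeff_isUnit f hf
  obtain ⟨c, hc⟩ := hu.exists_right_inv
  have hcu : IsUnit c := IsUnit.of_mul_eq_one_right _ hc
  have hcC : IsUnit (Polynomial.C c : (MvPolynomial (Fin n) k)[X]) := hcu.map Polynomial.C
  have hmonic : (e f * Polynomial.C c).Monic := by
    rw [Monic, Polynomial.leadingCoeff_mul, Polynomial.leadingCoeff_C, hc]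
  have hassoc : Associated (e f) (e f * Polynomial.C c) := associated_mul_unit_right _ _ hcC
  have hspan : Ideal.span {e f * Polynomial.C c, e g} = (Ideal.span {f, g}).map e := by
    rw [Ideal.map_span, Set.image_pair, Ideal.span_insert, Ideal.span_insert (e f)]
    congr 1
    exact (Ideal.span_singleton_eq_span_singleton.mpr hassoc).symm
  have hmem : ∀ w, e w ∈ Ideal.span {e f * Polynomial.C c, e g} ↔ w ∈ Ideal.span {f, g} := by
    intro w
    rw [hspan]
    constructor
    · intro h
      rwa [← Ideal.mem_comap, Ideal.comap_map_of_bijective e e.bijective] at h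
    · exact Ideal.mem_map_of_mem _
  rw [← hmem]
  refine unmixed_poly _ _ _ hmonic ?_ ?_
  · intro h hh
    rw [← hassoc.dvd_iff_dvd_left] at hh ⊢
    obtain ⟨h, rfl⟩ := e.surjective h
    rw [← map_mul, map_dvd_iff] at hh
    rw [map_dvd_iff]
    exact hg _ hh
  · intro P hP hr
    have := H (P.comap e) inferInstance (fun r hrz => by
      apply hr
      rw [← map_mul, hmem]; exact hrz)
    rwa [e.height_comap] at this
end Unmixed

section Lin
variable {k : Type} [Field k] {N : ℕ}

/-- The linear form with given coefficients. -/
def toLin (k : Type) [Field k] (N : ℕ) : (Fin N → k) →ₗ[k] MvPolynomial (Fin N) k :=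
  Fintype.linearCombination k (fun i => (MvPolynomial.X i : MvPolynomial (Fin N) k))

theorem toLin_single (i : Fin N) : toLin k N (Pi.single i 1) = MvPolynomial.X i := by
  simp [toLin]

theorem exists_toLin {p : MvPolynomial (Fin N) k} (hp : p.IsHomogeneous 1) :
    ∃ c, toLin k N c = p := by
  have : p ∈ homogeneousSubmodule (Fin N) k 1 := hp
  rw [homogeneousSubmodule_one_eq_span_X, ← Fintype.range_linearCombination] at this
  exact this

theorem exists_basis {V : Type} [AddCommGroup V] [Module k V] [FiniteDimensional k V] {m : ℕ}
    {c : Fin m → V} (hc : LinearIndependent k c) :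
    ∃ (τ : Type) (_ : Fintype τ) (B : Module.Basis (Fin m ⊕ τ) k V), ∀ i, B (Sum.inl i) = c i := by
  let B := Module.Basis.sumExtend hc
  have hfin : Finite (Fin m ⊕ Module.Basis.sumExtendIndex hc) := Module.Finite.finite_basis B
  have : Finite (Module.Basis.sumExtendIndex hc) := Finite.of_injective (Sum.inr (α := Fin m)) Sum.inr_injective
  refine ⟨_, Fintype.ofFinite _, B, fun i => ?_⟩
  simp [B, Module.Basis.sumExtend]
  rfl

theorem lin_equiv {m : ℕ} (l : Fin m → MvPolynomial (Fin N) k) (hl : ∀ i, (l i).IsHomogeneous 1)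
    (hli : LinearIndependent k l) :
    ∃ (τ : Type) (_ : Fintype τ) (e : MvPolynomial (Fin m ⊕ τ) k ≃ₐ[k] MvPolynomial (Fin N) k),
      ∀ i, e (X (Sum.inl i)) = l i := by
  choose c hc using fun i => exists_toLin (hl i)
  have hci : LinearIndependent k c := by
    apply LinearIndependent.of_comp (toLin k N)
    convert hli
    ext1 i; exact hc i
  obtain ⟨τ, _, B, hB⟩ := exists_basis hci
  let F : MvPolynomial (Fin m ⊕ τ) k →ₐ[k] MvPolynomial (Fin N) k := aeval fun s => toLin k N (B s)
  let g : (Fin N → k) →ₗ[k] MvPolynomial (Fin m ⊕ τ) k := B.constr k (fun s => X s)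
  have hgB : ∀ s, g (B s) = X s := fun s => B.constr_basis k _ s
  let G : MvPolynomial (Fin N) k →ₐ[k] MvPolynomial (Fin m ⊕ τ) k :=
    aeval fun i => g (Pi.single i 1)
  have h1 : F.toLinearMap ∘ₗ g = toLin k N := by
    apply B.ext
    intro s
    simp [hgB, F]
  have h2 : G.toLinearMap ∘ₗ toLin k N = g := by
    apply LinearMap.pi_ext'
    intro i
    ext
    simp [G, toLin_single]
  refine ⟨τ, inferInstance, AlgEquiv.ofAlgHom F G ?_ ?_, ?_⟩
  · apply MvPolynomial.algHom_ext
    intro i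
    have := LinearMap.congr_fun h1 (Pi.single i 1)
    rw [toLin_single] at this
    simpa [G] using this
  · apply MvPolynomial.algHom_ext
    intro s
    have := LinearMap.congr_fun h2 (B s)
    simpa [F, hgB] using this
  · intro i
    simp [F, hB, hc]

theorem lin_ev {m : ℕ} (l : Fin m → MvPolynomial (Fin N) k) (hl : ∀ i, (l i).IsHomogeneous 1)
    (hli : LinearIndependent k l) (c : Fin m → k) :
    ∃ ev : MvPolynomial (Fin N) k →ₐ[k] k, ∀ i, ev (l i) = c i := by
  obtain ⟨τ, _, e, he⟩ := lin_equiv l hl hli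
  refine ⟨(aeval (Sum.elim c 0)).comp e.symm.toAlgHom, fun i => ?_⟩
  simp [← he]

theorem lin_quot {m : ℕ} (l : Fin m → MvPolynomial (Fin N) k) (hl : ∀ i, (l i).IsHomogeneous 1)
    (hli : LinearIndependent k l) :
    ∃ (τ : Type) (φ : MvPolynomial (Fin N) k →ₐ[k] MvPolynomial τ k),
      Function.Surjective φ ∧ ∀ z, z ∈ Ideal.span (Set.range l) ↔ φ z = 0 := by
  obtain ⟨τ, _, e, he⟩ := lin_equiv l hl hli
  let p : MvPolynomial (Fin m ⊕ τ) k →ₐ[k] MvPolynomial τ k := aeval (Sum.elim 0 X)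
  let s : MvPolynomial τ k →ₐ[k] MvPolynomial (Fin m ⊕ τ) k := rename Sum.inr
  have hps : p.comp s = AlgHom.id k _ := by
    apply MvPolynomial.algHom_ext
    intro i
    simp [p, s]
  refine ⟨τ, p.comp e.symm.toAlgHom, ?_, fun z => ⟨fun hz => ?_, fun hz => ?_⟩⟩
  · intro w
    exact ⟨e (s w), by simpa using AlgHom.congr_fun hps w⟩
  · have : Ideal.span (Set.range l) ≤ RingHom.ker (p.comp e.symm.toAlgHom) := by
      rw [Ideal.span_le]
      rintro _ ⟨i, rfl⟩
      simp [← he, p]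
    exact this hz
  · let q := Ideal.Quotient.mkₐ k (Ideal.span (Set.range l))
    have : ((q.comp e.toAlgHom).comp s).comp p = q.comp e.toAlgHom := by
      apply MvPolynomial.algHom_ext
      rintro (i | i)
      · have : q (l i) = 0 := Ideal.Quotient.eq_zero_iff_mem.mpr (Ideal.subset_span ⟨i, rfl⟩)
        simp [p, he, this]
      · simp [p, s]
    have h := AlgHom.congr_fun this (e.symm z)
    have hz' : p (e.symm z) = 0 := hz
    rw [AlgHom.comp_apply, hz', map_zero] at h
    apply Ideal.Quotient.eq_zero_iff_mem.mp
    have h' : q z = 0 := by simpa using h.symm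
    exact h'

theorem idealHeight_eq {R : Type} [CommRing R] (J : Ideal R) : idealHeight J = J.height := by
  apply le_antisymm
  · rw [Ideal.height_eq_inf_minimalPrimes]
    refine le_iInf₂ fun P hP => ?_
    have hp := hP.1.1
    refine (iInf₂_le (⟨P, hp⟩ : {q : Ideal R // q.IsPrime}) hP.1.2).trans ?_
    rw [show P.height = _ from PrimeSpectrum.height_eq_orderHeight ⟨P, hp⟩]
    exact (Order.height_orderIso
      ((PrimeSpectrum.equivSubtype R).toOrderIso (fun _ _ h => h) (fun _ _ h => h))
        (⟨P, hp⟩ : PrimeSpectrum R)).le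
  · refine le_iInf₂ fun P hP => ?_
    refine (Ideal.height_mono hP).trans ?_
    rw [show P.1.height = _ from PrimeSpectrum.height_eq_orderHeight ⟨P.1, P.2⟩]
    exact (Order.height_orderIso
      ((PrimeSpectrum.equivSubtype R).toOrderIso (fun _ _ h => h) (fun _ _ h => h))
        (⟨P.1, P.2⟩ : PrimeSpectrum R)).ge
end Lin

section Consequences

theorem ht_le {R : Type} [CommRing R] [IsNoetherianRing R] {J : Ideal R} (s : Finset R) (n : ℕ)
    (hs : s.card ≤ n) (h : J ≤ Ideal.span (s : Set R))
    (hne : Ideal.span (s : Set R) ≠ ⊤) : J.height ≤ n := by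
  obtain ⟨p, hp⟩ := Ideal.nonempty_minimalPrimes hne
  have h1 := Ideal.height_le_card_of_mem_minimalPrimes_span_finset hp
  exact (Ideal.height_mono (h.trans hp.1.2)).trans (h1.trans (by exact_mod_cast hs))

theorem reg2_of_relPrime {R : Type} [CommRing R] [IsDomain R] [UniqueFactorizationMonoid R]
    {p q : R} (hq : q ≠ 0) (h : IsRelPrime p q) : Reg2 p q := by
  intro r s hrs
  have : q ∣ r * p := ⟨s, by rw [hrs]; ring⟩
  obtain ⟨n, hn⟩ := h.symm.dvd_of_dvd_mul_right this
  refine ⟨n, by rw [hn]; ring, ?_⟩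
  apply mul_right_cancel₀ hq
  rw [← hrs, hn]; ring

theorem reg2_of_prime {R : Type} [CommRing R] [IsDomain R] {p q : R} (hp0 : p ≠ 0)
    (hp : (Ideal.span {p}).IsPrime) (hq : q ∉ Ideal.span {p}) : Reg2 p q := by
  intro r s hrs
  have : s * q ∈ Ideal.span {p} := by
    rw [← hrs]; exact Ideal.mul_mem_left _ _ (Ideal.mem_span_singleton_self p)
  obtain ⟨n, hn⟩ := Ideal.mem_span_singleton'.mp ((hp.mem_or_mem this).resolve_right hq)
  refine ⟨n, ?_, hn.symm⟩
  apply mul_right_cancel₀ hp0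
  rw [hrs, ← hn]; ring

/-- The characterisation of `(x, y)^2 + (a x + b y)`. -/
theorem mem_K {R : Type} [CommRing R] {x y a b : R}
    (hab : RegMod (Ideal.span {x, y}) a b) (z : R) :
    z ∈ Ideal.span {x, y} ^ 2 ⊔ Ideal.span {a * x + b * y} ↔
      ∃ c e, c * b - e * a ∈ Ideal.span {x, y} ∧ z = c * x + e * y := by
  set P := Ideal.span {x, y} with hP
  have hxP : x ∈ P := mem_pair_left _ _
  have hyP : y ∈ P := mem_pair_right _ _
  rw [mem_sup_sing]
  constructor
  · rintro ⟨n, hn⟩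
    have key : ∀ w ∈ P ^ 2, ∃ c e, c ∈ P ∧ e ∈ P ∧ w = c * x + e * y := by
      intro w hw
      rw [pow_two] at hw
      induction hw using Submodule.mul_induction_on' with
      | mem_mul_mem m hm n hn =>
        obtain ⟨α, β, rfl⟩ := Ideal.mem_span_pair.mp hm
        exact ⟨α * n, β * n, P.mul_mem_left _ hn, P.mul_mem_left _ hn, by ring⟩
      | add w _ w' _ h h' =>
        obtain ⟨c, e, hc, he, rfl⟩ := h
        obtain ⟨c', e', hc', he', rfl⟩ := h'
        exact ⟨c + c', e + e', P.add_mem hc hc', P.add_mem he he', by ring⟩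
    obtain ⟨c, e, hc, he, h⟩ := key _ hn
    refine ⟨c + n * a, e + n * b, ?_, by linear_combination h⟩
    have := P.sub_mem (P.mul_mem_right b hc) (P.mul_mem_right a he)
    convert this using 1; ring
  · rintro ⟨c, e, h, rfl⟩
    obtain ⟨t, h1, h2⟩ := hab (-e) c (by convert h using 1; ring)
    refine ⟨-t, ?_⟩
    have := (P ^ 2).sub_mem (pow_two P ▸ Ideal.mul_mem_mul h2 hxP : (c + a * t) * x ∈ P ^ 2)
      (pow_two P ▸ Ideal.mul_mem_mul h1 hyP : (-e - b * t) * y ∈ P ^ 2)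
    convert this using 1; ring

theorem mem_prim {R : Type} [CommRing R] {I P : Ideal R} (hP : P.IsPrime) {j : R}
    (hj : j ∈ primaryComponent I P) : ∃ s, s ∉ P ∧ s * j ∈ I := by
  let A : Ideal R :=
    { carrier := {j | ∃ s, s ∉ P ∧ s * j ∈ I}
      add_mem' := by
        rintro j j' ⟨s, hs, h⟩ ⟨s', hs', h'⟩
        refine ⟨s * s', fun hh => (hP.mem_or_mem hh).elim hs hs', ?_⟩
        have := I.add_mem (I.mul_mem_left s' h) (I.mul_mem_left s h')
        convert this using 1; ring
      zero_mem' := ⟨1, (Ideal.ne_top_iff_one P).mp hP.ne_top, by simp⟩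
      smul_mem' := by
        rintro r j ⟨s, hs, h⟩
        refine ⟨s, hs, ?_⟩
        have := I.mul_mem_left r h
        convert this using 1
        simp only [smul_eq_mul]; ring }
  have : primaryComponent I P ≤ A := by
    refine iSup₂_le fun s hs => ?_
    intro w hw
    refine ⟨s, hs, ?_⟩
    have := (Submodule.mem_colon.mp hw) s (Ideal.mem_span_singleton_self s)
    rwa [smul_eq_mul, mul_comm] at this
  exact this hj

theorem le_unmixed {R : Type} [CommRing R] (I : Ideal R) : I ≤ unmixedPart I := by
  refine le_iInf₂ fun P hP => ?_
  refine le_trans ?_ (le_iSup₂ (f := fun (s : R) (_ : s ∉ P) => Submodule.colon I (Ideal.span {s}))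
    1 ((Ideal.ne_top_iff_one P).mp hP.1.ne_top))
  intro w hw
  rw [Submodule.mem_colon]
  intro t _
  exact I.mul_mem_right _ hw

variable {k : Type} [Field k] {N : ℕ}

theorem lin_prime {m : ℕ} (l : Fin m → MvPolynomial (Fin N) k) (hl : ∀ i, (l i).IsHomogeneous 1)
    (hli : LinearIndependent k l) : (Ideal.span (Set.range l)).IsPrime := by
  obtain ⟨τ, φ, -, h⟩ := lin_quot l hl hli
  have : Ideal.span (Set.range l) = RingHom.ker φ := by
    ext z; rw [h, RingHom.mem_ker]
  rw [this]
  exact RingHom.ker_isPrime _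

theorem regmod_of_height {x y a b : MvPolynomial (Fin N) k} (hx : x.IsHomogeneous 1)
    (hy : y.IsHomogeneous 1) (hli : LinearIndependent k ![x, y])
    (hht : (Ideal.span {a, b, x, y}).height = 4) : RegMod (Ideal.span {x, y}) a b := by
  classical
  obtain ⟨τ, φ, hφ, hker⟩ := lin_quot ![x, y] (by intro i; fin_cases i <;> assumption) hli
  have hr : Set.range ![x, y] = {x, y} := by
    simp [Matrix.range_cons, Set.pair_comm]
  rw [hr] at hker
  have hbig : ∀ d, (∃ s, φ a = φ s * φ d) → (∃ s, φ b = φ s * φ d) → IsUnit (φ d) := by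
    rintro d ⟨s, hs⟩ ⟨t, ht⟩
    by_contra hu
    have h1 : Ideal.span {d, x, y} ≠ ⊤ := by
      intro htop
      rw [Ideal.eq_top_iff_one, Ideal.mem_span_insert] at htop
      obtain ⟨r, z, hz, h1⟩ := htop
      apply hu
      have := congrArg φ h1
      rw [map_add, (hker z).mp hz, add_zero, map_mul, map_one] at this
      exact IsUnit.of_mul_eq_one_right _ this.symm
    have h2 : Ideal.span {a, b, x, y} ≤ Ideal.span {d, x, y} := by
      have hxy : Ideal.span {x, y} ≤ Ideal.span {d, x, y} := Ideal.span_mono (by simp)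
      have hd : d ∈ Ideal.span {d, x, y} := Ideal.subset_span (by simp)
      have e1 : a - s * d ∈ Ideal.span {x, y} := by rw [hker]; simp [hs]
      have e2 : b - t * d ∈ Ideal.span {x, y} := by rw [hker]; simp [ht]
      rw [Ideal.span_le]
      rintro z (rfl | rfl | rfl | rfl)
      · have := Ideal.add_mem _ (hxy e1) (Ideal.mul_mem_left _ s hd)
        simpa using this
      · have := Ideal.add_mem _ (hxy e2) (Ideal.mul_mem_left _ t hd)
        simpa using this
      · exact Ideal.subset_span (by simp)
      · exact Ideal.subset_span (by simp)
    have := ht_le (J := Ideal.span {a, b, x, y}) {d, x, y} 3 Finset.card_le_three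
      (by simpa using h2) (by simpa using h1)
    rw [hht] at this
    exact absurd this (by decide)
  have hrel : IsRelPrime (φ a) (φ b) := by
    intro d hda hdb
    obtain ⟨d, rfl⟩ := hφ d
    obtain ⟨s, hs⟩ := hda
    obtain ⟨t, ht⟩ := hdb
    obtain ⟨s, rfl⟩ := hφ s
    obtain ⟨t, rfl⟩ := hφ t
    exact hbig d ⟨s, by rw [hs, mul_comm]⟩ ⟨t, by rw [ht, mul_comm]⟩
  have hb0 : φ b ≠ 0 := by
    intro hb
    have hua : IsUnit (φ a) := hbig a ⟨1, by simp⟩ ⟨0, by simp [hb]⟩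
    obtain ⟨w, hw⟩ := hua.exists_right_inv
    obtain ⟨w, rfl⟩ := hφ w
    have h1 : a * w - 1 ∈ Ideal.span {x, y} := by rw [hker]; simp [hw]
    have hxy : Ideal.span {x, y} ≤ Ideal.span {a, b, x, y} := Ideal.span_mono (by
      intro z hz; simp at hz ⊢; tauto)
    have ha : a ∈ Ideal.span {a, b, x, y} := Ideal.subset_span (by simp)
    have : Ideal.span {a, b, x, y} = ⊤ := by
      rw [Ideal.eq_top_iff_one]
      have := Ideal.sub_mem _ (Ideal.mul_mem_right w _ ha) (hxy h1)
      simpa using this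
    rw [this, Ideal.height_top] at hht
    exact absurd hht (by decide)
  have hreg := reg2_of_relPrime hb0 hrel
  intro α β h
  rw [hker, map_add, map_mul, map_mul] at h
  obtain ⟨n, h1, h2⟩ := hreg (φ α) (- φ β) (by linear_combination h)
  obtain ⟨n, rfl⟩ := hφ n
  refine ⟨n, ?_, ?_⟩
  · rw [hker, map_sub, map_mul, h1]; ring
  · rw [hker, map_add, map_mul]; linear_combination -h2

theorem reg2_of_height {f g : MvPolynomial (Fin N) k} (h : (Ideal.span {f, g}).height = 2) :
    Reg2 f g ∧ f ≠ 0 ∧ g ≠ 0 := by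
  have htop : Ideal.span {f, g} ≠ ⊤ := by
    intro ht
    rw [ht, Ideal.height_top] at h
    exact absurd h (by decide)
  have hd : ∀ d, d ∣ f → d ∣ g → IsUnit d := by
    intro d h1 h2
    by_contra hu
    have := ht_le (J := Ideal.span {f, g}) {d} 1 (by simp) (by
      rw [Ideal.span_le]
      rintro z (rfl | rfl)
      · simpa [Ideal.mem_span_singleton] using h1
      · simpa [Ideal.mem_span_singleton] using h2) (by
      simpa [Ideal.span_singleton_eq_top] using hu)
    rw [h] at this
    exact absurd this (by decide)
  have hf : f ≠ 0 := by
    rintro rfl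
    exact htop (Ideal.eq_top_of_isUnit_mem _ (mem_pair_right _ _) (hd g (dvd_zero _) dvd_rfl))
  have hg : g ≠ 0 := by
    rintro rfl
    exact htop (Ideal.eq_top_of_isUnit_mem _ (mem_pair_left _ _) (hd f dvd_rfl (dvd_zero _)))
  exact ⟨reg2_of_relPrime hg (fun d h1 h2 => hd d h1 h2), hf, hg⟩

theorem colon_eq {f₁ f₂ f₃ : MvPolynomial (Fin N) k} (hN : N ≠ 0)
    (hI : (Ideal.span {f₁, f₂, f₃}).height = 2) (h12 : (Ideal.span {f₁, f₂}).height = 2)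
    (z : MvPolynomial (Fin N) k) :
    z * f₃ ∈ Ideal.span {f₁, f₂} ↔
      ∀ j ∈ unmixedPart (Ideal.span {f₁, f₂, f₃}), z * j ∈ Ideal.span {f₁, f₂} := by
  constructor
  · intro hz j hj
    obtain ⟨n, rfl⟩ := Nat.exists_eq_succ_of_ne_zero hN
    obtain ⟨hreg, hf0, -⟩ := reg2_of_height h12
    have hzI : ∀ i ∈ Ideal.span {f₁, f₂, f₃}, i * z ∈ Ideal.span {f₁, f₂} := by
      have : Ideal.span {f₁, f₂, f₃} ≤ (Ideal.span {f₁, f₂}).colon {z} := by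
        rw [Ideal.span_le]
        rintro w (rfl | rfl | rfl)
        · simpa [Submodule.mem_colon_singleton] using Ideal.mul_mem_right _ _ (mem_pair_left _ _)
        · simpa [Submodule.mem_colon_singleton] using Ideal.mul_mem_right _ _ (mem_pair_right _ _)
        · simpa [Submodule.mem_colon_singleton, mul_comm] using hz
      intro i hi
      simpa [Submodule.mem_colon_singleton] using this hi
    refine unmixed_mv f₁ f₂ (z * j) hf0 ?_ ?_
    · rintro h ⟨s, hs⟩
      obtain ⟨m, -, hm⟩ := hreg s h (by linear_combination -hs)
      exact ⟨m, by rw [hm]; ring⟩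
    · intro P hP hr
      by_contra hcon
      have hIP : Ideal.span {f₁, f₂, f₃} ≤ P := by
        intro i hi
        apply hr
        have := Ideal.mul_mem_right j _ (hzI i hi)
        rwa [mul_assoc] at this
      have hPh : P.height = 2 := le_antisymm (not_lt.mp hcon) (hI ▸ Ideal.height_mono hIP)
      have hj' : j ∈ primaryComponent (Ideal.span {f₁, f₂, f₃}) P := by
        have hle : unmixedPart (Ideal.span {f₁, f₂, f₃}) ≤
            primaryComponent (Ideal.span {f₁, f₂, f₃}) P :=
          iInf₂_le P ⟨hP, hIP, by rw [idealHeight_eq, idealHeight_eq, hPh, hI]⟩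
        exact hle hj
      obtain ⟨s, hs, hsj⟩ := mem_prim hP hj'
      apply hs
      apply hr
      have := hzI _ hsj
      convert this using 1; ring
  · intro h
    exact h _ (le_unmixed _ (Ideal.subset_span (by simp)))

end Consequences

section Cases
variable {k : Type} [Field k] {N : ℕ}

theorem hom1 {x : MvPolynomial (Fin N) k} (hx : x.IsHomogeneous 1) :
    ∀ i, (![x] i).IsHomogeneous 1 := by
  intro i; fin_cases i; exact hx

theorem hom2 {x y : MvPolynomial (Fin N) k} (hx : x.IsHomogeneous 1) (hy : y.IsHomogeneous 1) :
    ∀ i, (![x, y] i).IsHomogeneous 1 := by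
  intro i; fin_cases i <;> assumption

theorem hom3 {x y u : MvPolynomial (Fin N) k} (hx : x.IsHomogeneous 1) (hy : y.IsHomogeneous 1)
    (hu : u.IsHomogeneous 1) : ∀ i, (![x, y, u] i).IsHomogeneous 1 := by
  intro i; fin_cases i <;> assumption

theorem hom4 {x y u v : MvPolynomial (Fin N) k} (hx : x.IsHomogeneous 1) (hy : y.IsHomogeneous 1)
    (hu : u.IsHomogeneous 1) (hv : v.IsHomogeneous 1) :
    ∀ i, (![x, y, u, v] i).IsHomogeneous 1 := by
  intro i; fin_cases i <;> assumption

theorem prime1 {x : MvPolynomial (Fin N) k} (hx : x.IsHomogeneous 1) (h0 : x ≠ 0) :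
    (Ideal.span {x}).IsPrime := by
  have := lin_prime ![x] (hom1 hx) (by
    rw [linearIndependent_unique_iff]; simpa using h0)
  simpa [Matrix.range_cons] using this

theorem prime2 {x y : MvPolynomial (Fin N) k} (hx : x.IsHomogeneous 1) (hy : y.IsHomogeneous 1)
    (h : LinearIndependent k ![x, y]) : (Ideal.span {x, y}).IsPrime := by
  have := lin_prime ![x, y] (hom2 hx hy) h
  simpa [Matrix.range_cons, Set.pair_comm] using this

theorem prime3 {x y u : MvPolynomial (Fin N) k} (hx : x.IsHomogeneous 1) (hy : y.IsHomogeneous 1)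
    (hu : u.IsHomogeneous 1) (h : LinearIndependent k ![x, y, u]) :
    (Ideal.span {x, y, u}).IsPrime := by
  have := lin_prime ![x, y, u] (hom3 hx hy hu) h
  have hr : Set.range ![x, y, u] = {x, y, u} := by
    ext z; simp [Fin.exists_fin_succ, eq_comm]; tauto
  rwa [hr] at this

/-- `v ∉ (x)` -/
theorem notMem1 {x v : MvPolynomial (Fin N) k} (hx : x.IsHomogeneous 1)
    (hv : v.IsHomogeneous 1) (h : LinearIndependent k ![x, v]) : v ∉ Ideal.span {x} := by
  intro hm
  obtain ⟨ev, hev⟩ := lin_ev _ (hom2 hx hv) h ![0, 1]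
  have h0 : ev x = 0 := hev 0
  have h1 : ev v = 1 := hev 1
  obtain ⟨r, rfl⟩ := Ideal.mem_span_singleton'.mp hm
  simp [h0] at h1

theorem notMem2 {x y v : MvPolynomial (Fin N) k} (hx : x.IsHomogeneous 1)
    (hy : y.IsHomogeneous 1) (hv : v.IsHomogeneous 1)
    (h : LinearIndependent k ![x, y, v]) : v ∉ Ideal.span {x, y} := by
  intro hm
  obtain ⟨ev, hev⟩ := lin_ev _ (hom3 hx hy hv) h ![0, 0, 1]
  have h0 : ev x = 0 := hev 0
  have h0' : ev y = 0 := hev 1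
  have h1 : ev v = 1 := hev 2
  obtain ⟨r, s, rfl⟩ := Ideal.mem_span_pair.mp hm
  simp [h0, h0'] at h1

theorem mem_triple {R : Type} [CommRing R] {x y u z : R} :
    z ∈ Ideal.span {x, y, u} ↔ ∃ t, z - t * u ∈ Ideal.span {x, y} := by
  have : ({x, y, u} : Set R) = {x, y} ∪ {u} := by ext; simp; tauto
  rw [this, Ideal.span_union, mem_sup_sing]

theorem notMem3 {x y u v : MvPolynomial (Fin N) k} (hx : x.IsHomogeneous 1)
    (hy : y.IsHomogeneous 1) (hu : u.IsHomogeneous 1) (hv : v.IsHomogeneous 1)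
    (h : LinearIndependent k ![x, y, u, v]) : v ∉ Ideal.span {x, y, u} := by
  intro hm
  obtain ⟨ev, hev⟩ := lin_ev _ (hom4 hx hy hu hv) h ![0, 0, 0, 1]
  have h0 : ev x = 0 := hev 0
  have h0' : ev y = 0 := hev 1
  have h0'' : ev u = 0 := hev 2
  have h1 : ev v = 1 := hev 3
  obtain ⟨t, ht⟩ := mem_triple.mp hm
  obtain ⟨r, s, hrs⟩ := Ideal.mem_span_pair.mp ht
  have := congrArg ev hrs
  simp [h0, h0', h0'', h1] at this

theorem reg2_lin {x y : MvPolynomial (Fin N) k} (hx : x.IsHomogeneous 1) (hy : y.IsHomogeneous 1)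
    (h : LinearIndependent k ![x, y]) : Reg2 x y := by
  have hx0 : x ≠ 0 := h.ne_zero 0
  exact reg2_of_prime hx0 (prime1 hx hx0) (notMem1 hx hy h)

theorem li_sub3 {x y u : MvPolynomial (Fin N) k} (h : LinearIndependent k ![x, y, u]) :
    LinearIndependent k ![x, y] ∧ LinearIndependent k ![x, u] ∧
      LinearIndependent k ![x, u, y] := by
  refine ⟨?_, ?_, ?_⟩
  · convert h.comp ![0, 1] (by decide) using 1
    ext1 i; fin_cases i <;> rfl
  · convert h.comp ![0, 2] (by decide) using 1
    ext1 i; fin_cases i <;> rfl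
  · convert h.comp ![0, 2, 1] (by decide) using 1
    ext1 i; fin_cases i <;> rfl

theorem li_sub4 {x y u v : MvPolynomial (Fin N) k} (h : LinearIndependent k ![x, y, u, v]) :
    LinearIndependent k ![x, y, u] := by
  convert h.comp ![0, 1, 2] (by decide) using 1
  ext1 i; fin_cases i <;> rfl

section
variable {f1 f2 x y u v a b : MvPolynomial (Fin N) k} {L J : Ideal (MvPolynomial (Fin N) k)}

theorem case_indep (hC : Reg2 f1 f2) (hf10 : f1 ≠ 0) (hf20 : f2 ≠ 0)
    (h1J : f1 ∈ J) (h2J : f2 ∈ J) (hL : ∀ z, z ∈ L ↔ ∀ j ∈ J, z * j ∈ Ideal.span {f1, f2})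
    (hx : x.IsHomogeneous 1) (hy : y.IsHomogeneous 1)
    (hu : u.IsHomogeneous 1) (hv : v.IsHomogeneous 1)
    (hht : (Ideal.span {a, b, x, y}).height = 4)
    (hJ : J = (Ideal.span {x, y} ^ 2 ⊔ Ideal.span {a * x + b * y}) ⊓ Ideal.span {u, v})
    (huv : LinearIndependent k ![u, v])
    (hli : LinearIndependent k ![x, y, u, v]) : PdLT L 4 := by
  have h3 := li_sub4 hli
  have h2 := (li_sub3 h3).1
  have hab := regmod_of_height hx hy h2 hht
  subst hJ
  obtain ⟨c1, e1, hc1, hf1⟩ := (mem_K hab _).mp h1J.1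
  obtain ⟨c2, e2, hc2, hf2⟩ := (mem_K hab _).mp h2J.1
  obtain ⟨c1', e1', hf1'⟩ := Ideal.mem_span_pair.mp h1J.2
  obtain ⟨c2', e2', hf2'⟩ := Ideal.mem_span_pair.mp h2J.2
  refine pd_case4 hf1 hf2 hf1'.symm hf2'.symm hC hf10 hf20 (reg2_lin hx hy h2)
    (reg2_lin hu hv huv) (h2.ne_zero 0) (huv.ne_zero 0) (prime2 hx hy h2) hab hc1 hc2
    (notMem2 hx hy hu h3) ?_ (mem_K hab) hL
  intro r s hrs
  have hp := prime3 hx hy hu h3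
  have : r * v ∈ Ideal.span {x, y, u} := mem_triple.mpr ⟨s, hrs⟩
  exact mem_triple.mp ((hp.mem_or_mem this).resolve_right (notMem3 hx hy hu hv hli))

theorem case_same (hC : Reg2 f1 f2) (hf10 : f1 ≠ 0) (hf20 : f2 ≠ 0)
    (h1J : f1 ∈ J) (h2J : f2 ∈ J) (hL : ∀ z, z ∈ L ↔ ∀ j ∈ J, z * j ∈ Ideal.span {f1, f2})
    (hx : x.IsHomogeneous 1) (hy : y.IsHomogeneous 1)
    (hht : (Ideal.span {a, b, x, y}).height = 4)
    (hJ : J = Ideal.span {x, y} ^ 2 ⊔ Ideal.span {a * x + b * y})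
    (h2 : LinearIndependent k ![x, y]) : PdLT L 4 := by
  have hab := regmod_of_height hx hy h2 hht
  subst hJ
  obtain ⟨c1, e1, hc1, hf1⟩ := (mem_K hab _).mp h1J
  obtain ⟨c2, e2, hc2, hf2⟩ := (mem_K hab _).mp h2J
  refine pd_case3 (u := 1) (by rw [hf1, one_mul]) (by rw [hf2, one_mul]) hC hf10 hf20
    (reg2_lin hx hy h2) (by rw [one_mul]; exact reg2_lin hx hy h2) (h2.ne_zero 0)
    (prime2 hx hy h2) hab hc1 hc2 ?_
  intro z
  rw [hL]
  constructor
  · intro h c e hce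
    exact h _ ((mem_K hab _).mpr ⟨c, e, hce, by ring⟩)
  · intro h j hj
    obtain ⟨c, e, hce, rfl⟩ := (mem_K hab _).mp hj
    have := h c e hce
    rwa [one_mul] at this

theorem case_mid (hC : Reg2 f1 f2) (hf10 : f1 ≠ 0) (hf20 : f2 ≠ 0)
    (h1J : f1 ∈ J) (h2J : f2 ∈ J) (hL : ∀ z, z ∈ L ↔ ∀ j ∈ J, z * j ∈ Ideal.span {f1, f2})
    (hx : x.IsHomogeneous 1) (hy : y.IsHomogeneous 1) (hu : u.IsHomogeneous 1)
    (hht : (Ideal.span {a, b, x, y}).height = 4)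
    (hJ : J = (Ideal.span {x, y} ^ 2 ⊔ Ideal.span {a * x + b * y}) ⊓ Ideal.span {x, u})
    (h3 : LinearIndependent k ![x, y, u]) : PdLT L 4 := by
  obtain ⟨h2, hxu, hxuy⟩ := li_sub3 h3
  have hab := regmod_of_height hx hy h2 hht
  have hx0 : x ≠ 0 := h2.ne_zero 0
  have hPp := prime2 hx hy h2
  have hQp := prime3 hx hy hu h3
  have huP := notMem2 hx hy hu h3
  have hx1 := prime1 hx hx0
  have hxq : Reg2 x (u * y) := by
    refine reg2_of_prime hx0 hx1 fun h => ?_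
    exact (hx1.mem_or_mem h).elim (notMem1 hx hu hxu) (notMem1 hx hy h2)
  have hTp := prime2 hx hu hxu
  have hyT := notMem2 hx hu hy hxuy
  set P := Ideal.span {x, y} with hPdef
  have hxP : x ∈ P := mem_pair_left _ _
  have hyP : y ∈ P := mem_pair_right _ _
  have hJmem : ∀ z, z ∈ J ↔ ∃ c e, c * b - e * (u * a) ∈ P ∧ z = c * x + e * (u * y) := by
    intro z
    rw [hJ, Submodule.mem_inf, mem_K hab]
    constructor
    · rintro ⟨⟨c, e', hce, rfl⟩, hT⟩
      have h1 : e' * y ∈ Ideal.span {x, u} := by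
        have := Ideal.sub_mem _ hT (Ideal.mul_mem_left _ c (mem_pair_left x u))
        simpa using this
      obtain ⟨α, e, rfl⟩ := Ideal.mem_span_pair.mp ((hTp.mem_or_mem h1).resolve_right hyT)
      refine ⟨c + α * y, e, ?_, by ring⟩
      have := P.add_mem hce (P.add_mem (P.mul_mem_left (α * a) hxP) (P.mul_mem_left (α * b) hyP))
      convert this using 1; ring
    · rintro ⟨c, e, hce, rfl⟩
      refine ⟨⟨c, e * u, by convert hce using 1; ring, by ring⟩, ?_⟩
      exact Ideal.mem_span_pair.mpr ⟨c, e * y, by ring⟩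
  have uP : ∀ c, u * c ∈ P → c ∈ P := fun c h => (hPp.mem_or_mem h).resolve_left huP
  by_cases hbQ : b ∈ Ideal.span {x, y, u}
  · obtain ⟨b', hb'⟩ := mem_triple.mp hbQ
    have hcond : ∀ c e, c * b - e * (u * a) ∈ P ↔ c * b' - e * a ∈ P := by
      intro c e
      constructor
      · intro h
        apply uP
        have := P.sub_mem h (P.mul_mem_left c hb')
        convert this using 1; ring
      · intro h
        have := P.add_mem (P.mul_mem_left u h) (P.mul_mem_left c hb')
        convert this using 1; ring
    have hab' : RegMod P a b' := by
      intro α β h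
      obtain ⟨c, h1, h2⟩ := hab (u * α) β (by
        have := P.add_mem (P.mul_mem_left u h) (P.mul_mem_right β hb')
        convert this using 1; ring)
      refine ⟨c, uP _ ?_, h2⟩
      have := P.add_mem h1 (P.mul_mem_right c hb')
      convert this using 1; ring
    obtain ⟨c1, e1, hc1, hf1⟩ := (hJmem _).mp h1J
    obtain ⟨c2, e2, hc2, hf2⟩ := (hJmem _).mp h2J
    refine pd_case3 hf1 hf2 hC hf10 hf20 (reg2_lin hx hy h2) hxq hx0 hPp hab'
      ((hcond _ _).mp hc1) ((hcond _ _).mp hc2) ?_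
    intro z
    rw [hL]
    constructor
    · intro h c e hce
      exact h _ ((hJmem _).mpr ⟨c, e, (hcond _ _).mpr hce, rfl⟩)
    · intro h j hj
      obtain ⟨c, e, hce, rfl⟩ := (hJmem _).mp hj
      exact h c e ((hcond _ _).mp hce)
  · have hab' : RegMod P (u * a) b := by
      intro α β h
      obtain ⟨c, h1, h2⟩ := hab (u * α) β (by convert h using 1; ring)
      have hbc : b * c ∈ Ideal.span {x, y, u} := by
        refine mem_triple.mpr ⟨α, ?_⟩
        have := P.neg_mem h1
        convert this using 1; ring
      obtain ⟨c', hc'⟩ := mem_triple.mp ((hQp.mem_or_mem hbc).resolve_left hbQ)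
      refine ⟨c', uP _ ?_, ?_⟩
      · have := P.add_mem h1 (P.mul_mem_left b hc')
        convert this using 1; ring
      · have := P.sub_mem h2 (P.mul_mem_left a hc')
        convert this using 1; ring
    obtain ⟨c1, e1, hc1, hf1⟩ := (hJmem _).mp h1J
    obtain ⟨c2, e2, hc2, hf2⟩ := (hJmem _).mp h2J
    refine pd_case3 hf1 hf2 hC hf10 hf20 (reg2_lin hx hy h2) hxq hx0 hPp hab' hc1 hc2 ?_
    intro z
    rw [hL]
    constructor
    · intro h c e hce
      exact h _ ((hJmem _).mpr ⟨c, e, hce, rfl⟩)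
    · intro h j hj
      obtain ⟨c, e, hce, rfl⟩ := (hJmem _).mp hj
      exact h c e hce

theorem case_share (hC : Reg2 f1 f2) (hf10 : f1 ≠ 0) (hf20 : f2 ≠ 0)
    (h1J : f1 ∈ J) (h2J : f2 ∈ J) (hL : ∀ z, z ∈ L ↔ ∀ j ∈ J, z * j ∈ Ideal.span {f1, f2})
    (hx : x.IsHomogeneous 1) (hy : y.IsHomogeneous 1) (hu : u.IsHomogeneous 1)
    (hht : (Ideal.span {a, b, x, y}).height = 4)
    (hJ : J = (Ideal.span {x, y} ^ 2 ⊔ Ideal.span {a * x + b * y}) ⊓ Ideal.span {x, u})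
    (h2 : LinearIndependent k ![x, y]) (hxu : LinearIndependent k ![x, u]) : PdLT L 4 := by
  by_cases h3 : LinearIndependent k ![x, y, u]
  · exact case_mid hC hf10 hf20 h1J h2J hL hx hy hu hht hJ h3
  · rw [Fintype.not_linearIndependent_iff] at h3
    obtain ⟨g, hg, hne⟩ := h3
    rw [Fin.sum_univ_three] at hg
    simp only [Matrix.cons_val_zero, Matrix.cons_val_one, Matrix.cons_val_two, Matrix.head_cons,
      Matrix.tail_cons, Matrix.cons_val] at hg
    rw [LinearIndependent.pair_iff] at h2 hxu
    have hg1 : g 1 ≠ 0 := by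
      intro h0
      rw [h0, zero_smul, add_zero] at hg
      obtain ⟨h, h'⟩ := hxu _ _ hg
      obtain ⟨i, hi⟩ := hne
      have hz : ∀ i, g i = 0 := by
        intro i; fin_cases i
        exacts [h, h0, h']
      exact hi (hz i)
    have hle : Ideal.span {x, y} ≤ Ideal.span {x, u} := by
      rw [Ideal.span_le]
      rintro z (rfl | rfl)
      · exact mem_pair_left _ _
      · refine Ideal.mem_span_pair.mpr ⟨C (-(g 1)⁻¹ * g 0), C (-(g 1)⁻¹ * g 2), ?_⟩
        rw [← smul_eq_C_mul, ← smul_eq_C_mul, mul_smul, mul_smul, ← smul_add]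
        have : g 0 • x + g 2 • u = - (g 1 • z) := by linear_combination hg
        rw [this, smul_neg, neg_smul, neg_neg, smul_smul, inv_mul_cancel₀ hg1, one_smul]
    have hK : Ideal.span {x, y} ^ 2 ⊔ Ideal.span {a * x + b * y} ≤ Ideal.span {x, u} := by
      refine (sup_le ?_ ?_).trans hle
      · exact Ideal.pow_le_self two_ne_zero
      · rw [Ideal.span_singleton_le_iff_mem]
        exact Ideal.mem_span_pair.mpr ⟨a, b, rfl⟩
    rw [inf_eq_left.mpr hK] at hJ
    exact case_same hC hf10 hf20 h1J h2J hL hx hy hht hJ (LinearIndependent.pair_iff.mpr h2)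

theorem case_dep (hC : Reg2 f1 f2) (hf10 : f1 ≠ 0) (hf20 : f2 ≠ 0)
    (h1J : f1 ∈ J) (h2J : f2 ∈ J) (hL : ∀ z, z ∈ L ↔ ∀ j ∈ J, z * j ∈ Ideal.span {f1, f2})
    (hx : x.IsHomogeneous 1) (hy : y.IsHomogeneous 1)
    (hu : u.IsHomogeneous 1) (hv : v.IsHomogeneous 1)
    (hht : (Ideal.span {a, b, x, y}).height = 4)
    (hJ : J = (Ideal.span {x, y} ^ 2 ⊔ Ideal.span {a * x + b * y}) ⊓ Ideal.span {u, v})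
    (h2 : LinearIndependent k ![x, y]) (huv : LinearIndependent k ![u, v])
    (α β γ ε : k) (hα : α ≠ 0) (hγ : γ ≠ 0)
    (hrel : α • x + β • y = γ • u + ε • v) : PdLT L 4 := by
  rw [LinearIndependent.pair_iff] at h2 huv
  set x' := α • x + β • y with hx'
  have hx'h : x'.IsHomogeneous 1 := by
    have h1 : ∀ (c : k) (p : MvPolynomial (Fin N) k), p.IsHomogeneous 1 → (c • p).IsHomogeneous 1 :=
      fun c p hp => (homogeneousSubmodule (Fin N) k 1).smul_mem c hp
    exact (h1 _ _ hx).add (h1 _ _ hy)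
  have hCα : (C α⁻¹ * C α : MvPolynomial (Fin N) k) = 1 := by
    rw [← C_mul, inv_mul_cancel₀ hα, C_1]
  have hCγ : (C γ⁻¹ * C γ : MvPolynomial (Fin N) k) = 1 := by
    rw [← C_mul, inv_mul_cancel₀ hγ, C_1]
  have hxC : x' = C α * x + C β * y := by rw [hx', smul_eq_C_mul, smul_eq_C_mul]
  have hxC' : x' = C γ * u + C ε * v := by rw [hrel, smul_eq_C_mul, smul_eq_C_mul]
  have hxx : x = C α⁻¹ * x' - C α⁻¹ * C β * y := by rw [hxC]; linear_combination -x * hCα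
  have huu : u = C γ⁻¹ * x' - C γ⁻¹ * C ε * v := by rw [hxC']; linear_combination -u * hCγ
  clear_value x'
  have hP : Ideal.span {x, y} = Ideal.span {x', y} := by
    apply le_antisymm <;> rw [Ideal.span_le]
    · intro z hz
      rcases hz with hz | hz <;> rw [hz]
      · exact Ideal.mem_span_pair.mpr ⟨C α⁻¹, - (C α⁻¹ * C β), by linear_combination -hxx⟩
      · exact mem_pair_right _ _
    · intro z hz
      rcases hz with hz | hz <;> rw [hz]
      · exact Ideal.mem_span_pair.mpr ⟨C α, C β, hxC.symm⟩
      · exact mem_pair_right _ _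
  have hT : Ideal.span {u, v} = Ideal.span {x', v} := by
    apply le_antisymm <;> rw [Ideal.span_le]
    · intro z hz
      rcases hz with hz | hz <;> rw [hz]
      · exact Ideal.mem_span_pair.mpr ⟨C γ⁻¹, - (C γ⁻¹ * C ε), by linear_combination -huu⟩
      · exact mem_pair_right _ _
    · intro z hz
      rcases hz with hz | hz <;> rw [hz]
      · exact Ideal.mem_span_pair.mpr ⟨C γ, C ε, hxC'.symm⟩
      · exact mem_pair_right _ _
  have hA : Ideal.span {a, b, x, y} =
      Ideal.span {C α⁻¹ * a, b - C α⁻¹ * C β * a, x', y} := by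
    have e1 : ∀ p q : MvPolynomial (Fin N) k, Ideal.span {p, q, x, y} =
        Ideal.span {p, q} ⊔ Ideal.span {x, y} := by
      intro p q
      rw [← Ideal.span_union]; congr 1
      ext; simp; tauto
    have e2 : ∀ p q : MvPolynomial (Fin N) k, Ideal.span {p, q, x', y} =
        Ideal.span {p, q} ⊔ Ideal.span {x', y} := by
      intro p q
      rw [← Ideal.span_union]; congr 1
      ext; simp; tauto
    rw [e1, e2, hP]
    congr 1
    apply le_antisymm <;> rw [Ideal.span_le]
    · rintro z (rfl | rfl)
      · exact Ideal.mem_span_pair.mpr ⟨C α, 0, by linear_combination z * hCα⟩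
      · exact Ideal.mem_span_pair.mpr ⟨C β, 1, by ring⟩
    · rintro z (rfl | rfl)
      · exact Ideal.mem_span_pair.mpr ⟨C α⁻¹, 0, by ring⟩
      · exact Ideal.mem_span_pair.mpr ⟨-(C α⁻¹ * C β), 1, by ring⟩
  have hg : a * x + b * y = C α⁻¹ * a * x' + (b - C α⁻¹ * C β * a) * y := by
    rw [hxC]; linear_combination -a * x * hCα
  rw [hP, hT, hg] at hJ
  rw [hA] at hht
  refine case_share hC hf10 hf20 h1J h2J hL hx'h hy hv hht hJ ?_ ?_
  · rw [LinearIndependent.pair_iff]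
    intro s t hst
    obtain ⟨h, h'⟩ := h2 (s * α) (s * β + t) (by
      rw [← hst, hx', smul_add, add_smul, mul_smul, mul_smul]; abel)
    have hs : s = 0 := (mul_eq_zero.mp h).resolve_right hα
    subst hs
    simpa using h'
  · rw [LinearIndependent.pair_iff]
    intro s t hst
    obtain ⟨h, h'⟩ := huv (s * γ) (s * ε + t) (by
      rw [← hst, hrel, smul_add, add_smul, mul_smul, mul_smul]; abel)
    have hs : s = 0 := (mul_eq_zero.mp h).resolve_right hγ
    subst hs
    simpa using h'

theorem case_all (hC : Reg2 f1 f2) (hf10 : f1 ≠ 0) (hf20 : f2 ≠ 0)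
    (h1J : f1 ∈ J) (h2J : f2 ∈ J) (hL : ∀ z, z ∈ L ↔ ∀ j ∈ J, z * j ∈ Ideal.span {f1, f2})
    (hx : x.IsHomogeneous 1) (hy : y.IsHomogeneous 1)
    (hu : u.IsHomogeneous 1) (hv : v.IsHomogeneous 1)
    (hht : (Ideal.span {a, b, x, y}).height = 4)
    (hJ : J = (Ideal.span {x, y} ^ 2 ⊔ Ideal.span {a * x + b * y}) ⊓ Ideal.span {u, v})
    (h2 : LinearIndependent k ![x, y]) (huv : LinearIndependent k ![u, v]) : PdLT L 4 := by
  by_cases hli : LinearIndependent k ![x, y, u, v]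
  · exact case_indep hC hf10 hf20 h1J h2J hL hx hy hu hv hht hJ huv hli
  rw [Fintype.not_linearIndependent_iff] at hli
  obtain ⟨g, hg, hne⟩ := hli
  rw [Fin.sum_univ_four] at hg
  simp only [Matrix.cons_val_zero, Matrix.cons_val_one, Matrix.cons_val] at hg
  have hrel : g 0 • x + g 1 • y = (- g 2) • u + (- g 3) • v := by
    rw [neg_smul, neg_smul]; linear_combination hg
  have h2' := LinearIndependent.pair_iff.mp h2
  have huv' := LinearIndependent.pair_iff.mp huv
  have hswap1 : LinearIndependent k ![y, x] := by
    rw [LinearIndependent.pair_iff]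
    intro s t h
    exact (h2' t s (by rw [add_comm]; exact h)).symm
  have hswap2 : LinearIndependent k ![v, u] := by
    rw [LinearIndependent.pair_iff]
    intro s t h
    exact (huv' t s (by rw [add_comm]; exact h)).symm
  have hA : Ideal.span {b, a, y, x} = Ideal.span {a, b, x, y} := by
    rw [Set.insert_comm b a, Set.pair_comm y x]
  have hJ' : J = (Ideal.span {y, x} ^ 2 ⊔ Ideal.span {b * y + a * x}) ⊓ Ideal.span {u, v} := by
    rw [hJ, Set.pair_comm y x, add_comm (b * y)]
  have hsw : (g 0 ≠ 0 ∨ g 1 ≠ 0) ∧ (g 2 ≠ 0 ∨ g 3 ≠ 0) := by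
    constructor
    · by_contra! h
      rw [h.1, h.2, zero_smul, zero_smul, add_zero] at hrel
      obtain ⟨h3, h4⟩ := huv' _ _ hrel.symm
      obtain ⟨i, hi⟩ := hne
      have hz : ∀ i, g i = 0 := by
        intro i; fin_cases i
        exacts [h.1, h.2, neg_eq_zero.mp h3, neg_eq_zero.mp h4]
      exact hi (hz i)
    · by_contra! h
      rw [h.1, h.2, neg_zero, zero_smul, zero_smul, add_zero] at hrel
      obtain ⟨h3, h4⟩ := h2' _ _ hrel
      obtain ⟨i, hi⟩ := hne
      have hz : ∀ i, g i = 0 := by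
        intro i; fin_cases i
        exacts [h3, h4, h.1, h.2]
      exact hi (hz i)
  obtain ⟨hs1, hs2⟩ := hsw
  rcases hs1 with h0 | h1 <;> rcases hs2 with h3 | h4
  · exact case_dep hC hf10 hf20 h1J h2J hL hx hy hu hv hht hJ h2 huv _ _ _ _ h0
      (neg_ne_zero.mpr h3) hrel
  · exact case_dep hC hf10 hf20 h1J h2J hL hx hy hv hu hht (by rw [hJ, Set.pair_comm v u])
      h2 hswap2 _ _ _ _ h0 (neg_ne_zero.mpr h4) (by rw [hrel, add_comm])
  · exact case_dep hC hf10 hf20 h1J h2J hL hy hx hu hv (hA ▸ hht) hJ' hswap1 huv _ _ _ _ h1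
      (neg_ne_zero.mpr h3) (by rw [← hrel, add_comm])
  · exact case_dep hC hf10 hf20 h1J h2J hL hy hx hv hu (hA ▸ hht)
      (by rw [hJ', Set.pair_comm v u])
      hswap1 hswap2 _ _ _ _ h1 (neg_ne_zero.mpr h4)
      (by rw [add_comm, hrel, add_comm])

end

theorem li_or {x y : MvPolynomial (Fin N) k} (h : ¬ LinearIndependent k ![x, y]) :
    (∃ c : MvPolynomial (Fin N) k, x = c * y) ∨ (∃ c : MvPolynomial (Fin N) k, y = c * x) := by
  rw [LinearIndependent.pair_iff] at h
  push Not at h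
  obtain ⟨s, t, hst, hne⟩ := h
  rw [smul_eq_C_mul, smul_eq_C_mul] at hst
  by_cases hs : s = 0
  · have ht := hne hs
    have hCt : (C t⁻¹ * C t : MvPolynomial (Fin N) k) = 1 := by
      rw [← C_mul, inv_mul_cancel₀ ht, C_1]
    exact Or.inr ⟨-(C t⁻¹ * C s), by linear_combination (-y) * hCt + C t⁻¹ * hst⟩
  · have hCs : (C s⁻¹ * C s : MvPolynomial (Fin N) k) = 1 := by
      rw [← C_mul, inv_mul_cancel₀ hs, C_1]
    exact Or.inl ⟨-(C s⁻¹ * C t), by linear_combination (-x) * hCs + C s⁻¹ * hst⟩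

theorem li_of_height {x y a b : MvPolynomial (Fin N) k}
    (hht : (Ideal.span {a, b, x, y}).height = 4) : LinearIndependent k ![x, y] := by
  classical
  by_contra h
  have key : ∀ w, w ∈ ({x, y} : Set (MvPolynomial (Fin N) k)) →
      x ∈ Ideal.span {w} → y ∈ Ideal.span {w} → False := by
    intro w hw h1 h2
    have hle : Ideal.span {w} ≤ Ideal.span {a, b, w} := Ideal.span_mono (by simp)
    have hle2 : Ideal.span {a, b, x, y} ≤ Ideal.span {a, b, w} := by
      rw [Ideal.span_le]
      rintro z (rfl | rfl | rfl | rfl)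
      · exact Ideal.subset_span (by simp)
      · exact Ideal.subset_span (by simp)
      · exact hle h1
      · exact hle h2
    have hle3 : Ideal.span {a, b, w} ≤ Ideal.span {a, b, x, y} := Ideal.span_mono (by
      rintro z (rfl | rfl | rfl)
      · simp
      · simp
      · simp at hw ⊢; tauto)
    have := ht_le (J := Ideal.span {a, b, x, y}) {a, b, w} 3 Finset.card_le_three
      (by simpa using hle2) (by
        intro ht
        have : Ideal.span {a, b, x, y} = ⊤ := top_le_iff.mp (le_trans (by simpa using ht.ge) hle3)
        rw [this, Ideal.height_top] at hht
        exact absurd hht (by decide))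
    rw [hht] at this
    exact absurd this (by decide)
  rcases li_or h with ⟨c, hc⟩ | ⟨c, hc⟩
  · exact key y (by simp) (Ideal.mem_span_singleton'.mpr ⟨c, hc.symm⟩)
      (Ideal.mem_span_singleton_self y)
  · exact key x (by simp) (Ideal.mem_span_singleton_self x)
      (Ideal.mem_span_singleton'.mpr ⟨c, hc.symm⟩)

theorem li_of_le {u v : MvPolynomial (Fin N) k} (hu : u.IsHomogeneous 1) (hv : v.IsHomogeneous 1)
    {I : Ideal (MvPolynomial (Fin N) k)} (hI : I.height = 2) (hle : I ≤ Ideal.span {u, v}) :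
    LinearIndependent k ![u, v] := by
  by_contra h
  have hcc : ∀ w : MvPolynomial (Fin N) k, w.IsHomogeneous 1 → Ideal.span {w} ≠ ⊤ := by
    intro w hw htop
    rw [Ideal.eq_top_iff_one, Ideal.mem_span_singleton'] at htop
    obtain ⟨r, hr⟩ := htop
    have h0 : constantCoeff w = 0 := hw.coeff_eq_zero (by simp)
    have := congrArg constantCoeff hr
    simp [h0] at this
  have key : ∀ w : MvPolynomial (Fin N) k, w.IsHomogeneous 1 →
      u ∈ Ideal.span {w} → v ∈ Ideal.span {w} → False := by
    intro w hw h1 h2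
    have hle2 : Ideal.span {u, v} ≤ Ideal.span {w} := by
      rw [Ideal.span_le]
      rintro z (rfl | rfl) <;> assumption
    have := ht_le (J := I) {w} 1 (by simp) (by simpa using hle.trans hle2)
      (by simpa using hcc w hw)
    rw [hI] at this
    exact absurd this (by decide)
  rcases li_or h with ⟨c, hc⟩ | ⟨c, hc⟩
  · exact key v hv (Ideal.mem_span_singleton'.mpr ⟨c, hc.symm⟩)
      (Ideal.mem_span_singleton_self v)
  · exact key u hu (Ideal.mem_span_singleton_self u)
      (Ideal.mem_span_singleton'.mpr ⟨c, hc.symm⟩)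

end Cases

theorem statement_10
    {k : Type} [Field k] [IsAlgClosed k] {N : ℕ}
    (f₁ f₂ f₃ : MvPolynomial (Fin N) k)
    (hf₁ : f₁.IsHomogeneous 3) (hf₂ : f₂.IsHomogeneous 3) (hf₃ : f₃.IsHomogeneous 3)
    (hIht : idealHeight (Ideal.span {f₁, f₂, f₃}) = 2)
    (hht₁₂ : idealHeight (Ideal.span {f₁, f₂}) = 2)
    (hht₁₃ : idealHeight (Ideal.span {f₁, f₃}) = 2)
    (hht₂₃ : idealHeight (Ideal.span {f₂, f₃}) = 2)
    (x y u v : MvPolynomial (Fin N) k)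
    (hx : x.IsHomogeneous 1) (hy : y.IsHomogeneous 1)
    (hu : u.IsHomogeneous 1) (hv : v.IsHomogeneous 1)
    (a b : MvPolynomial (Fin N) k) (d : ℕ)
    (ha : a.IsHomogeneous d) (hb : b.IsHomogeneous d)
    (hht : idealHeight (Ideal.span {a, b, x, y}) = 4)
    (hun : unmixedPart (Ideal.span {f₁, f₂, f₃}) =
      (Ideal.span {x, y} ^ 2 ⊔ Ideal.span {a * x + b * y}) ⊓ Ideal.span {u, v}) :
    pdQuotLE (Ideal.span {f₁, f₂, f₃}) 4 := by
  rw [idealHeight_eq] at hIht hht₁₂ hht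
  have hxy := li_of_height hht
  have hN : N ≠ 0 := by
    rintro rfl
    have hx0 : x ≠ 0 := hxy.ne_zero 0
    apply hx0
    have := hx.coeff_eq_zero (d := 0) (by simp)
    rw [MvPolynomial.eq_C_of_isEmpty x, this, C_0]
  set I := Ideal.span {f₁, f₂, f₃} with hI
  have hIJ := le_unmixed I
  have huv : LinearIndependent k ![u, v] :=
    li_of_le hu hv hIht ((hun ▸ hIJ).trans inf_le_right)
  obtain ⟨hreg, hf10, hf20⟩ := reg2_of_height hht₁₂
  let L : Ideal (MvPolynomial (Fin N) k) := (Ideal.span {f₁, f₂}).colon (unmixedPart I : Set _)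
  have hL : ∀ z, z ∈ L ↔ ∀ j ∈ unmixedPart I, z * j ∈ Ideal.span {f₁, f₂} := fun z =>
    Submodule.mem_colon
  have hpd : PdLT L 4 := case_all hreg hf10 hf20 (hIJ (Ideal.subset_span (by simp)))
    (hIJ (Ideal.subset_span (by simp))) hL hx hy hu hv hht hun hxy huv
  have hfin : PdLT (Ideal.span {f₁, f₂} ⊔ Ideal.span {f₃}) 5 := by
    refine pd_step f₃ 4 (L := L) (fun r => ?_) hpd ((pd_pair hreg hf10).mono (by norm_num))
    rw [hL, colon_eq hN hIht hht₁₂]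
  have hIeq : I = Ideal.span {f₁, f₂} ⊔ Ideal.span {f₃} := by
    rw [hI, ← Ideal.span_union]; congr 1
    ext; simp; tauto
  rw [← hIeq] at hfin
  exact exists_res_of_pd 4 _ hfin

end
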